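/- Grant Assumptions 1–4 of the paper. Then for any n ≥ n₀ ∨ n₁, sup_{θ*∈S¹} sup_{f∈F(β₀,M)} P_F( F̂_∞ ∉ [‖F‖_∞, 3M + 4C₅(n)] ) ≤ (8+Υ)·n^{−4r}, where ‖F‖_∞ = sup_{x∈[−5/2,5/2]²}|F(x)| and C₅(n) = ‖K‖₁² + (n𝔥²)^{−1/2}C₄(n) + 1/2 with C₄(n) the paper's explicit constant. -/

import Mathlib

open MeasureTheory Real

noncomputable section

namespace SingleIndex

/-- Inner product of two points of `ℝ²`. -/
def dot2 (a b : Fin 2 → ℝ) : ℝ := a 0 * b 0 + a 1 * b 1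

/-- The unit circle `S¹ ⊂ ℝ²`. -/
def S1 : Set (Fin 2 → ℝ) := {θ | θ 0 ^ 2 + θ 1 ^ 2 = 1}

/-- The Hölder ball `F(β₀, M)`: functions with `‖f‖_∞ + Hölder seminorm ≤ M`. -/
def HolderBall (β₀ M : ℝ) : Set (ℝ → ℝ) :=
  {f | ∃ A B : ℝ, A + B ≤ M ∧ (∀ y, |f y| ≤ A) ∧
    ∀ y₁ y₂ : ℝ, |f y₁ - f y₂| ≤ B * |y₁ - y₂| ^ β₀}

/-- Assumption 4 on the kernel `K`. -/
structure KernelHyp (K : ℝ → ℝ) (Q : ℝ) : Prop where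
  supp : ∀ u : ℝ, u ∉ Set.Icc (-(1/2) : ℝ) (1/2) → K u = 0
  norm_one : ∫ u : ℝ, K u = 1
  symm : ∀ u : ℝ, K (-u) = K u
  lip : ∀ u v : ℝ, |K u - K v| ≤ Q * |u - v|

/-- `‖K‖_∞`. -/
def Ksup (K : ℝ → ℝ) : ℝ := ⨆ u : ℝ, |K u|

/-- `‖K‖₁`. -/
def K1 (K : ℝ → ℝ) : ℝ := ∫ u : ℝ, |K u|

/-- The monotone approximation error `Δ_{K,f}(h,z)`. -/
def Delta (K f : ℝ → ℝ) (h z : ℝ) : ℝ :=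
  sSup {v | ∃ δ : ℝ, 0 < δ ∧ δ ≤ h ∧
    v = |δ⁻¹ * ∫ u : ℝ, K ((u - z) / δ) * (f u - f z)|}

/-- The Hardy–Littlewood maximal function `Δ*_{K,f}(h,y)` of `Δ_{K,f}(h,·)`. -/
def DeltaStar (K f : ℝ → ℝ) (h y : ℝ) : ℝ :=
  sSup {v | ∃ a : ℝ, 0 < a ∧
    v = (2 * a)⁻¹ * ∫ z in Set.Icc (y - a) (y + a), Delta K f h z}

/-- `h_min = n⁻¹ ln^{1+2/ω}(n)`. -/
def hmin (ω : ℝ) (n : ℕ) : ℝ := (n : ℝ)⁻¹ * Real.log n ^ ((1 : ℝ) + 2 / ω)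

/-- `𝔥 = √(n⁻¹ ln^{1+1/ω}(n))`. -/
def frakh (ω : ℝ) (n : ℕ) : ℝ := Real.sqrt ((n : ℝ)⁻¹ * Real.log n ^ ((1 : ℝ) + 1 / ω))

/-- The oracle bandwidth `h*_{K,f}(y)`. -/
def hstar (K f : ℝ → ℝ) (ω : ℝ) (n : ℕ) (y : ℝ) : ℝ :=
  sSup {h | h ∈ Set.Icc (hmin ω n) 1 ∧
    Real.sqrt (n * h) * DeltaStar K f h y ≤ Ksup K * Real.sqrt (Real.log n)}

/-- The minimal sample size `n₀`. -/
def n0 (β₀ M ω : ℝ) : ℕ :=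
  sInf {m : ℕ | 1 ≤ m ∧ ∀ n : ℕ, m ≤ n →
    max M 1 * max (frakh ω n ^ β₀) (Real.log n ^ ((1 : ℝ) / ω) * hmin ω n ^ β₀) ≤ 1}

/-- The noise class `𝔓` (Assumption 1): symmetric densities with the prescribed tail bound. -/
def NoiseClass (Υ Ωc ω : ℝ) : Set (ℝ → ℝ) :=
  {p | (∀ y, 0 ≤ p y) ∧ (∫ y : ℝ, p y = 1) ∧ (∀ y, p (-y) = p y) ∧
    ∀ x : ℝ, 0 ≤ x → ∫ y in Set.Ici x, p y ≤ Υ * Real.exp (-Ωc * x ^ ω)}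

/-- Assumption 2 on the design density `g`: a density bounded below by `gl` on `[-3,3]²`. -/
def DesignOK (g : (Fin 2 → ℝ) → ℝ) (gl : ℝ) : Prop :=
  (∀ x, 0 ≤ g x) ∧ (∫ x : Fin 2 → ℝ, g x = 1) ∧
    ∀ x ∈ Set.Icc (fun _ : Fin 2 => (-3 : ℝ)) (fun _ : Fin 2 => (3 : ℝ)), gl ≤ g x

/-- Two-dimensional product kernel `K(u,v) = K(u)K(v)`. -/
def K2 (K : ℝ → ℝ) (v : Fin 2 → ℝ) : ℝ := K (v 0) * K (v 1)

/-- The matrix `E_{(θ,h)}`. -/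
def Emat (θ : Fin 2 → ℝ) (h : ℝ) : Matrix (Fin 2) (Fin 2) ℝ :=
  !![θ 0 / h, θ 1 / h; -θ 1, θ 0]

/-- The matrix `Ē_{(θ,h)(ν,h)}`. -/
def Ebar (θ ν : Fin 2 → ℝ) (h : ℝ) : Matrix (Fin 2) (Fin 2) ℝ :=
  !![(θ 0 + ν 0) / (2 * h * (1 + |dot2 ν θ|)), (θ 1 + ν 1) / (2 * h * (1 + |dot2 ν θ|));
     -((θ 1 + ν 1) / (2 * (1 + |dot2 ν θ|))), (θ 0 + ν 0) / (2 * (1 + |dot2 ν θ|))]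

/-- The matrix `E_{(θ,h)(ν,h)}` with the sign convention. -/
def Epair (θ ν : Fin 2 → ℝ) (h : ℝ) : Matrix (Fin 2) (Fin 2) ℝ :=
  if 0 ≤ dot2 ν θ then Ebar θ ν h else Ebar (-θ) ν h

/-- Generic kernel estimator associated with a matrix `E`, as a function of the data
`d : Fin n → (ℝ² × ℝ)`, `X_i = (d i).1`, `Y_i = (d i).2`. -/
def estM (K : ℝ → ℝ) (g : (Fin 2 → ℝ) → ℝ) (n : ℕ)
    (E : Matrix (Fin 2) (Fin 2) ℝ) (t : Fin 2 → ℝ)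
    (d : Fin n → (Fin 2 → ℝ) × ℝ) : ℝ :=
  (E.det / n) * ∑ i : Fin n, K2 K (E.mulVec ((d i).1 - t)) * (d i).2 / g ((d i).1)

/-- Joint law of a single observation `(X_i, Y_i)` where `Y_i = F(X_i) + ε_i`:
density `g(x) p(y - F(x))` w.r.t. Lebesgue measure on `ℝ² × ℝ`. -/
def jointLaw (g : (Fin 2 → ℝ) → ℝ) (p : ℝ → ℝ) (F : (Fin 2 → ℝ) → ℝ) :
    Measure ((Fin 2 → ℝ) × ℝ) :=
  volume.withDensity fun z => ENNReal.ofReal (g z.1 * p (z.2 - F z.1))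

/-- Law `P_F^{(n)}` of the i.i.d. sample `(X_1,Y_1),…,(X_n,Y_n)`. -/
def dataLaw (n : ℕ) (g : (Fin 2 → ℝ) → ℝ) (p : ℝ → ℝ) (F : (Fin 2 → ℝ) → ℝ) :
    Measure (Fin n → (Fin 2 → ℝ) × ℝ) :=
  Measure.pi fun _ => jointLaw g p F

end SingleIndex
namespace SingleIndex

/-- Parameters of the model and of the procedure. -/
structure Pars where
  /-- the univariate kernel -/
  K : ℝ → ℝ
  /-- Lipschitz constant of the kernel -/
  Q : ℝ
  /-- the design density -/
  g : (Fin 2 → ℝ) → ℝ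
  /-- lower bound of `g` on `[-3,3]²` -/
  gl : ℝ
  /-- tail constant of the noise class -/
  Υ : ℝ
  /-- tail exponent constant `Ω` of the noise class -/
  Ωc : ℝ
  /-- tail power `ω` of the noise class -/
  ω : ℝ
  /-- order of the risk -/
  r : ℝ

/-- `σ² = sup_{p ∈ 𝔓} ∫ x² p(x) dx`. -/
def sigma2 (P : Pars) : ℝ :=
  sSup {v | ∃ p ∈ NoiseClass P.Υ P.Ωc P.ω, v = ∫ x : ℝ, x ^ 2 * p x}

/-- `τ = (Ω⁻¹(4r+1) ln n)^{1/ω}`. -/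
def tauf (P : Pars) (n : ℕ) : ℝ := (P.Ωc⁻¹ * (4 * P.r + 1) * Real.log n) ^ ((1 : ℝ) / P.ω)

/-- The quantity `c₁(n)`. -/
def c1f (P : Pars) (n : ℕ) : ℝ :=
  730 * Real.log (16 * (n : ℝ) ^ 2 * P.gl ^ (-(1/2) : ℝ) * (12 * P.Q + Real.sqrt 2))
    + 8 * P.r * Real.log n + 394

/-- The quantity `c₂(n)`. -/
def c2f (P : Pars) (n : ℕ) : ℝ :=
  730 * Real.log (16 * (n : ℝ) ^ 2 * tauf P n * P.gl ^ (-(1/2) : ℝ) * (12 * P.Q + Real.sqrt 2))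
    + 8 * P.r * Real.log n + 394

/-- The quantity `c₃(n)`. -/
def c3f (P : Pars) (n : ℕ) : ℝ :=
  365 * Real.log (5 * (n : ℝ) ^ 2 * P.Q * P.gl ^ (-(1/2) : ℝ)) + 8 * P.r * Real.log n + 197

/-- The quantity `c₄(n)`. -/
def c4f (P : Pars) (n : ℕ) : ℝ :=
  365 * Real.log (5 * (n : ℝ) ^ 2 * tauf P n * P.Q * P.gl ^ (-(1/2) : ℝ))
    + 8 * P.r * Real.log n + 197

/-- The constant `C₁(n)`. -/
def C1f (P : Pars) (n : ℕ) : ℝ :=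
  2 * Real.sqrt 2 * P.gl ^ (-(1/2) : ℝ) * Ksup P.K ^ 2 * Real.sqrt (c1f P n)
    + 8 / 3 * c1f P n * Real.log n ^ (-((2 + P.ω) / (2 * P.ω))) * P.gl⁻¹ * Ksup P.K ^ 2

/-- The constant `C₂(n)`. -/
def C2f (P : Pars) (n : ℕ) : ℝ :=
  2 * Real.sqrt 2 * max (Real.sqrt (sigma2 P)) 1 * P.gl ^ (-(1/2) : ℝ) * Ksup P.K ^ 2
      * Real.sqrt (c2f P n)
    + 8 / 3 * c2f P n * Real.log n ^ (-(1/2) : ℝ) * P.gl⁻¹ * Ksup P.K ^ 2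
      * (P.Ωc⁻¹ * (4 * P.r + 1)) ^ ((1 : ℝ) / P.ω)

/-- The constant `C₃(n)`. -/
def C3f (P : Pars) (n : ℕ) : ℝ :=
  2 * Real.sqrt 2 * P.gl ^ (-(1/2) : ℝ) * Ksup P.K ^ 2 * Real.sqrt (c3f P n)
    + 8 / 3 * P.gl⁻¹ * Ksup P.K ^ 2 * c3f P n * ((n : ℝ) * frakh P.ω n ^ 2) ^ (-(1/2) : ℝ)

/-- The constant `C₄(n)`. -/
def C4f (P : Pars) (n : ℕ) : ℝ :=
  2 * Real.sqrt 2 * max (Real.sqrt (sigma2 P)) 1 * P.gl ^ (-(1/2) : ℝ) * Ksup P.K ^ 2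
      * Real.sqrt (c4f P n)
    + 8 / 3 * tauf P n * c4f P n * ((n : ℝ) * frakh P.ω n ^ 2) ^ (-(1/2) : ℝ)
      * P.gl⁻¹ * Ksup P.K ^ 2

/-- The constant `C₅(n)`. -/
def C5f (P : Pars) (n : ℕ) : ℝ :=
  K1 P.K ^ 2 + ((n : ℝ) * frakh P.ω n ^ 2) ^ (-(1/2) : ℝ) * C4f P n + 1 / 2

/-- `n₁`: the minimal sample size linked to `(n𝔥²)^{-1/2} C₃(n) ≤ 1/2`. -/
def n1 (P : Pars) : ℕ :=
  sInf {m : ℕ | 1 ≤ m ∧ ∀ n : ℕ, m ≤ n →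
    ((n : ℝ) * frakh P.ω n ^ 2) ^ (-(1/2) : ℝ) * C3f P n ≤ 1 / 2}

/-- The auxiliary estimator `F̂(v)` with bandwidth `𝔥`. -/
def FhatAux (P : Pars) (n : ℕ) (d : Fin n → (Fin 2 → ℝ) × ℝ) (v : Fin 2 → ℝ) : ℝ :=
  (n : ℝ)⁻¹ * ∑ i : Fin n, (P.g ((d i).1))⁻¹ * (frakh P.ω n) ^ (-2 : ℤ) *
    P.K (((d i).1 0 - v 0) / frakh P.ω n) * P.K (((d i).1 1 - v 1) / frakh P.ω n) * (d i).2

/-- `F̂_∞ = 2 sup_{v ∈ [-5/2,5/2]²} |F̂(v)| + 2C₅(n)`. -/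
def FhatInf (P : Pars) (n : ℕ) (d : Fin n → (Fin 2 → ℝ) × ℝ) : ℝ :=
  2 * sSup {w | ∃ v ∈ Set.Icc (fun _ : Fin 2 => -(5/2 : ℝ)) (fun _ : Fin 2 => (5/2 : ℝ)),
      w = |FhatAux P n d v|}
    + 2 * C5f P n

/-- The random threshold `TH(η)`. -/
def TH (P : Pars) (n : ℕ) (d : Fin n → (Fin 2 → ℝ) × ℝ) (η : ℝ) : ℝ :=
  2 * (Ksup P.K ^ 2 * Real.sqrt (Real.log n) + FhatInf P n d * C1f P n + C2f P n)
    * (η * n) ^ (-(1/2) : ℝ)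

/-- The dyadic bandwidth grid `H_n = {2^{-k} : k ∈ ℕ} ∩ [h_min/2, 1]`. -/
def Hgrid (ω : ℝ) (n : ℕ) : Set ℝ :=
  {h | (∃ k : ℕ, h = (2 : ℝ) ^ (-(k : ℤ))) ∧ hmin ω n / 2 ≤ h ∧ h ≤ 1}

/-- The quantity `R^{(1)}_t(θ,h)`. -/
def R1 (P : Pars) (n : ℕ) (t : Fin 2 → ℝ) (θ : Fin 2 → ℝ) (h : ℝ)
    (d : Fin n → (Fin 2 → ℝ) × ℝ) : ℝ :=
  sSup {v | ∃ η ∈ Hgrid P.ω n, η ≤ h ∧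
    v = max (sSup {w | ∃ ν ∈ S1,
          w = |estM P.K P.g n (Epair θ ν η) t d - estM P.K P.g n (Emat ν η) t d|}
        - TH P n d η) 0}

/-- The quantity `R^{(2)}_t(h)`. -/
def R2 (P : Pars) (n : ℕ) (t : Fin 2 → ℝ) (h : ℝ)
    (d : Fin n → (Fin 2 → ℝ) × ℝ) : ℝ :=
  sSup {v | ∃ η ∈ Hgrid P.ω n, η ≤ h ∧
    v = max (sSup {w | ∃ θ ∈ S1,
          w = |estM P.K P.g n (Emat θ h) t d - estM P.K P.g n (Emat θ η) t d|}
        - TH P n d η) 0}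

/-- `(θ̂, ĥ)`, as a function of the data, is a solution of the minimization problem
(2.5) defining the selection rule at the point `t`. -/
def IsSelector (P : Pars) (n : ℕ) (t : Fin 2 → ℝ)
    (sel : (Fin n → (Fin 2 → ℝ) × ℝ) → (Fin 2 → ℝ) × ℝ) : Prop :=
  ∀ d, (sel d).1 ∈ S1 ∧ (sel d).2 ∈ Hgrid P.ω n ∧
    ∀ θ ∈ S1, ∀ h ∈ Hgrid P.ω n,
      R1 P n t (sel d).1 (sel d).2 d + R2 P n t (sel d).2 d + TH P n d (sel d).2
        ≤ R1 P n t θ h d + R2 P n t h d + TH P n d h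

/-- The selected estimator `F̂_{(θ̂,ĥ)}(t)` as a function of the data. -/
def selEst (P : Pars) (n : ℕ) (t : Fin 2 → ℝ)
    (sel : (Fin n → (Fin 2 → ℝ) × ℝ) → (Fin 2 → ℝ) × ℝ)
    (d : Fin n → (Fin 2 → ℝ) × ℝ) : ℝ :=
  estM P.K P.g n (Emat (sel d).1 (sel d).2) t d

end SingleIndex

namespace SingleIndex

/-- `‖F‖_∞ = sup_{x ∈ [-5/2,5/2]²} |F(x)|`. -/
def FsupNorm (F : (Fin 2 → ℝ) → ℝ) : ℝ :=
  sSup {w | ∃ x ∈ Set.Icc (fun _ : Fin 2 => -(5/2 : ℝ)) (fun _ : Fin 2 => (5/2 : ℝ)),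
    w = |F x|}

/-- Bernstein-type moment generating function bound for a bounded variable. -/
lemma integral_exp_mul_le {α : Type*} [MeasurableSpace α] (μ : Measure α)
    [IsProbabilityMeasure μ] {Z : α → ℝ} (hZ : AEStronglyMeasurable Z μ) {b s l : ℝ}
    (hZb : ∀ z, |Z z| ≤ b) (hZs : ∫ z, Z z ^ 2 ∂μ ≤ s ^ 2) (hl : 0 ≤ l) (hlb : l * b ≤ 1) :
    Integrable (fun z => exp (l * Z z)) μ ∧
      ∫ z, exp (l * Z z) ∂μ ≤ exp (l * ∫ z, Z z ∂μ + l ^ 2 * s ^ 2) := by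
  have hZint : Integrable Z μ := Integrable.of_bound hZ b (Filter.Eventually.of_forall hZb)
  have hZsq : Integrable (fun z => Z z ^ 2) μ := by
    refine Integrable.of_bound (hZ.pow 2) (b ^ 2) (Filter.Eventually.of_forall fun z => ?_)
    rw [Real.norm_eq_abs, abs_pow]
    exact pow_le_pow_left₀ (abs_nonneg _) (hZb z) 2
  have hle : ∀ z, |l * Z z| ≤ 1 := fun z => by
    rw [abs_mul, abs_of_nonneg hl]
    exact (mul_le_mul_of_nonneg_left (hZb z) hl).trans hlb
  have hintexp : Integrable (fun z => exp (l * Z z)) μ := by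
    refine Integrable.of_bound (C := exp 1)
      (Real.continuous_exp.comp_aestronglyMeasurable (hZ.const_mul l))
      (Filter.Eventually.of_forall fun z => ?_)
    rw [Real.norm_eq_abs, abs_of_pos (exp_pos _)]
    exact exp_le_exp.2 ((le_abs_self _).trans (hle z))
  refine ⟨hintexp, ?_⟩
  calc ∫ z, exp (l * Z z) ∂μ ≤ ∫ z, (1 + l * Z z + l ^ 2 * Z z ^ 2) ∂μ := by
        refine integral_mono hintexp
          (((integrable_const 1).add (hZint.const_mul l)).add (hZsq.const_mul (l ^ 2))) fun z => ?_
        have := (abs_le.1 (Real.abs_exp_sub_one_sub_id_le (hle z))).2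
        simp only
        nlinarith
    _ = 1 + l * ∫ z, Z z ∂μ + l ^ 2 * ∫ z, Z z ^ 2 ∂μ := by
        have h1 : Integrable (fun z => 1 + l * Z z) μ :=
          (integrable_const 1).add (hZint.const_mul l)
        rw [integral_add h1 (hZsq.const_mul (l ^ 2)),
          integral_add (integrable_const 1) (hZint.const_mul l), integral_const_mul,
          integral_const_mul]
        simp
    _ ≤ (l * ∫ z, Z z ∂μ + l ^ 2 * s ^ 2) + 1 := by
        nlinarith [mul_le_mul_of_nonneg_left hZs (sq_nonneg l)]
    _ ≤ _ := Real.add_one_le_exp _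

/-- One-sided Bernstein inequality for i.i.d. sums of bounded variables. -/
lemma pi_upper_deviation_le {α : Type*} [MeasurableSpace α] (μ : Measure α)
    [IsProbabilityMeasure μ] {Z : α → ℝ} (hZ : AEStronglyMeasurable Z μ) {b s x : ℝ}
    (hb : 0 < b) (hs : 0 < s) (hx : 0 < x)
    (hZb : ∀ z, |Z z| ≤ b) (hZs : ∫ z, Z z ^ 2 ∂μ ≤ s ^ 2) {n : ℕ} (hn : 0 < n) :
    Measure.pi (fun _ : Fin n => μ)
      {d | 2 * s * √(n * x) + b * x ≤ ∑ i, Z (d i) - n * ∫ z, Z z ∂μ}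
        ≤ ENNReal.ofReal (exp (-x)) := by
  have hn' : (0 : ℝ) < n := by exact_mod_cast hn
  set m := ∫ z, Z z ∂μ with hm
  obtain ⟨l, hl, hlb, hlx⟩ : ∃ l : ℝ, 0 < l ∧ l * b ≤ 1 ∧
      n * (l ^ 2 * s ^ 2) - l * (2 * s * √(n * x) + b * x) ≤ -x := by
    have hq : 0 < √(n * x) := Real.sqrt_pos.2 (by positivity)
    have hq2 : √(n * x) ^ 2 = n * x := Real.sq_sqrt (by positivity)
    set q := √(n * x)
    have hxq : x = q ^ 2 / n := by rw [hq2]; field_simp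
    by_cases hc : q * b ≤ n * s
    · refine ⟨q / (n * s), by positivity,
        by rw [div_mul_eq_mul_div, div_le_one (by positivity)]; exact hc, ?_⟩
      have h1 : n * ((q / (n * s)) ^ 2 * s ^ 2) = x := by rw [hxq]; field_simp
      have h2 : q / (n * s) * (2 * s * q + b * x) = 2 * x + q / (n * s) * (b * x) := by
        rw [mul_add]; congr 1; rw [hxq]; field_simp
      have h3 : 0 ≤ q / (n * s) * (b * x) := by positivity
      linarith
    · push Not at hc
      refine ⟨1 / b, by positivity, by rw [one_div, inv_mul_cancel₀ hb.ne'], ?_⟩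
      have h1 : n * ((1 / b) ^ 2 * s ^ 2) = (n * s) * s / b ^ 2 := by field_simp
      have h2 : 1 / b * (2 * s * q + b * x) = 2 * ((q * b) * s / b ^ 2) + x := by field_simp
      have h3 : (n * s) * s / b ^ 2 ≤ (q * b) * s / b ^ 2 := by gcongr
      have h4 : 0 ≤ (q * b) * s / b ^ 2 := by positivity
      linarith
  set t := 2 * s * √(n * x) + b * x
  obtain ⟨hi, hle⟩ := integral_exp_mul_le μ hZ hZb hZs hl.le hlb
  have hI : Integrable (fun d : Fin n → α => ∏ i, exp (l * Z (d i))) (Measure.pi fun _ => μ) :=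
    Integrable.fintype_prod (f := fun _ z => exp (l * Z z)) fun _ => hi
  have hmk := mul_meas_ge_le_integral_of_nonneg
    (Filter.Eventually.of_forall fun d => Finset.prod_nonneg fun i _ => (exp_pos _).le) hI
    (exp (l * (t + n * m)))
  rw [integral_fintype_prod_eq_pow (fun z => exp (l * Z z)), Fintype.card_fin] at hmk
  have hset : {d : Fin n → α | t ≤ ∑ i, Z (d i) - n * m} =
      {d | exp (l * (t + n * m)) ≤ ∏ i, exp (l * Z (d i))} := by
    ext d
    simp only [Set.mem_ofPred_eq]
    rw [← Real.exp_sum, ← Finset.mul_sum, exp_le_exp, mul_le_mul_iff_right₀ hl, le_sub_iff_add_le]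
  rw [hset, ← ENNReal.ofReal_toReal (measure_ne_top (Measure.pi fun _ : Fin n => μ) _)]
  refine ENNReal.ofReal_le_ofReal ?_
  have h2 : (∫ z, exp (l * Z z) ∂μ) ^ n ≤ exp (n * (l * m + l ^ 2 * s ^ 2)) := by
    rw [Real.exp_nat_mul]
    exact pow_le_pow_left₀ (integral_nonneg fun _ => (exp_pos _).le) hle n
  rw [← mul_le_mul_iff_right₀ (exp_pos (l * (t + n * m)))]
  refine (hmk.trans h2).trans ?_
  rw [← Real.exp_add]
  apply exp_le_exp.2
  nlinarith

/-- Two-sided Bernstein inequality for i.i.d. sums of bounded variables. -/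
lemma pi_abs_deviation_le {α : Type*} [MeasurableSpace α] (μ : Measure α)
    [IsProbabilityMeasure μ] {Z : α → ℝ} (hZ : AEStronglyMeasurable Z μ) {b s x : ℝ}
    (hb : 0 < b) (hs : 0 < s) (hx : 0 < x)
    (hZb : ∀ z, |Z z| ≤ b) (hZs : ∫ z, Z z ^ 2 ∂μ ≤ s ^ 2) {n : ℕ} (hn : 0 < n) :
    Measure.pi (fun _ : Fin n => μ)
      {d | 2 * s * √(n * x) + b * x ≤ |∑ i, Z (d i) - n * ∫ z, Z z ∂μ|}
        ≤ ENNReal.ofReal (2 * exp (-x)) := by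
  have h1 := pi_upper_deviation_le μ hZ hb hs hx hZb hZs hn
  have h2 := pi_upper_deviation_le μ hZ.neg hb hs hx (fun z => by simpa using hZb z)
    (by simpa using hZs) hn
  rw [two_mul (exp (-x)), ENNReal.ofReal_add (exp_pos _).le (exp_pos _).le]
  refine (measure_mono ?_).trans ((measure_union_le _ _).trans (add_le_add h1 h2))
  intro d hd
  rw [Set.mem_ofPred_eq] at hd
  rcases le_abs.1 hd with h | h
  · exact Or.inl h
  · right
    simp only [Set.mem_ofPred_eq, Pi.neg_apply, Finset.sum_neg_distrib, integral_neg]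
    linarith

/-- The joint law is the image of the product of design and noise laws. -/
lemma jointLaw_eq_map {g : (Fin 2 → ℝ) → ℝ} {p : ℝ → ℝ} {F : (Fin 2 → ℝ) → ℝ}
    (hg : AEMeasurable g) (hp : AEMeasurable p) (hg0 : ∀ x, 0 ≤ g x) (hF : Measurable F) :
    jointLaw g p F = Measure.map (fun z : (Fin 2 → ℝ) × ℝ => (z.1, F z.1 + z.2))
      ((volume.withDensity fun x => ENNReal.ofReal (g x)).prod
        (volume.withDensity fun y => ENNReal.ofReal (p y))) := by
  have hmeas : Measurable fun z : (Fin 2 → ℝ) × ℝ => (z.1, F z.1 + z.2) := by fun_prop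
  let ψ : (Fin 2 → ℝ) × ℝ ≃ᵐ (Fin 2 → ℝ) × ℝ :=
    { toFun := fun z => (z.1, F z.1 + z.2)
      invFun := fun z => (z.1, z.2 - F z.1)
      left_inv := fun z => by simp
      right_inv := fun z => by simp
      measurable_toFun := hmeas
      measurable_invFun := by
        show Measurable fun z : (Fin 2 → ℝ) × ℝ => (z.1, z.2 - F z.1)
        fun_prop }
  have hψ : MeasurePreserving ψ volume volume :=
    MeasurePreserving.skew_product (μa := volume) (μb := volume) (μc := volume) (μd := volume)
      (g := fun x y => F x + y) (MeasurePreserving.id _) (by fun_prop)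
      (Filter.Eventually.of_forall fun x => map_add_left_eq_self volume (F x))
  ext s hs
  rw [Measure.map_apply hmeas hs, prod_withDensity₀ hg.ennreal_ofReal hp.ennreal_ofReal,
    withDensity_apply _ (hmeas hs), jointLaw, withDensity_apply _ hs]
  rw [← hψ.setLIntegral_comp_preimage_emb ψ.measurableEmbedding]
  refine lintegral_congr fun z => ?_
  simp [ψ, ENNReal.ofReal_mul (hg0 _)]

/-- The measure on a space with Lebesgue density `g`. -/
def densityLaw {α : Type*} [MeasureSpace α] (g : α → ℝ) : Measure α :=
  volume.withDensity fun x => ENNReal.ofReal (g x)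

lemma integrable_of_integral_eq_one' {α : Type*} [MeasureSpace α] {g : α → ℝ}
    (hg : ∫ x, g x = 1) : Integrable g := by
  by_contra h
  rw [integral_undef h] at hg
  exact zero_ne_one hg

lemma isProbabilityMeasure_densityLaw {α : Type*} [MeasureSpace α] {g : α → ℝ}
    (hg0 : ∀ x, 0 ≤ g x) (hg : ∫ x, g x = 1) : IsProbabilityMeasure (densityLaw g) := by
  refine ⟨?_⟩
  rw [densityLaw, withDensity_apply _ MeasurableSet.univ, Measure.restrict_univ,
    ← ofReal_integral_eq_lintegral_ofReal (integrable_of_integral_eq_one' hg)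
      (Filter.Eventually.of_forall hg0), hg, ENNReal.ofReal_one]

lemma integral_densityLaw {α : Type*} [MeasureSpace α] {g : α → ℝ}
    (hg0 : ∀ x, 0 ≤ g x) (hg : AEMeasurable g) (φ : α → ℝ) :
    ∫ x, φ x ∂densityLaw g = ∫ x, g x * φ x := by
  rw [densityLaw, integral_withDensity_eq_integral_toReal_smul₀ hg.ennreal_ofReal
    (Filter.Eventually.of_forall fun _ => ENNReal.ofReal_lt_top)]
  refine integral_congr_ae (Filter.Eventually.of_forall fun x => ?_)
  simp [ENNReal.toReal_ofReal (hg0 x)]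

lemma aestronglyMeasurable_densityLaw {α : Type*} [MeasureSpace α] {g φ : α → ℝ}
    (hφ : AEStronglyMeasurable φ) : AEStronglyMeasurable φ (densityLaw g) :=
  hφ.mono_ac (withDensity_absolutelyContinuous _ _)

section Noise

variable {Υ Ωc ω : ℝ} {p : ℝ → ℝ}

lemma NoiseClass.tail_le (hp : p ∈ NoiseClass Υ Ωc ω) {T : ℝ} (hT : 0 ≤ T) :
    densityLaw p {y | T < |y|} ≤ ENNReal.ofReal (2 * (Υ * exp (-Ωc * T ^ ω))) := by
  obtain ⟨h0, h1, hs, ht⟩ := hp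
  have hpi := integrable_of_integral_eq_one' h1
  have hset : ∀ s : Set ℝ, MeasurableSet s →
      densityLaw p s = ENNReal.ofReal (∫ y in s, p y) := fun s hs' => by
    rw [densityLaw, withDensity_apply _ hs',
      ← ofReal_integral_eq_lintegral_ofReal hpi.integrableOn (Filter.Eventually.of_forall h0)]
  have e1 : densityLaw p (Set.Ici T) ≤ ENNReal.ofReal (Υ * exp (-Ωc * T ^ ω)) := by
    rw [hset _ measurableSet_Ici]
    exact ENNReal.ofReal_le_ofReal (ht T hT)
  have e2 : densityLaw p (Set.Iic (-T)) ≤ ENNReal.ofReal (Υ * exp (-Ωc * T ^ ω)) := by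
    rw [hset _ measurableSet_Iic]
    refine ENNReal.ofReal_le_ofReal (le_trans (le_of_eq ?_) (ht T hT))
    have := integral_comp_neg_Iic (-T) p
    rw [neg_neg] at this
    rw [integral_Ici_eq_integral_Ioi, ← this]
    simp only [hs]
  have hpos : 0 ≤ Υ * exp (-Ωc * T ^ ω) := (integral_nonneg h0).trans (ht T hT)
  rw [two_mul (Υ * _), ENNReal.ofReal_add hpos hpos]
  refine (measure_mono ?_).trans ((measure_union_le _ _).trans (add_le_add e1 e2))
  intro y hy
  rw [Set.mem_ofPred_eq] at hy
  rcases lt_abs.1 hy with h | h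
  · exact Or.inl h.le
  · exact Or.inr (by rw [Set.mem_Iic]; linarith)

lemma NoiseClass.integral_odd (hp : p ∈ NoiseClass Υ Ωc ω) {κ : ℝ → ℝ}
    (hκ : ∀ y, κ (-y) = -κ y) : ∫ y, κ y ∂densityLaw p = 0 := by
  obtain ⟨h0, h1, hs, -⟩ := hp
  rw [integral_densityLaw h0 (integrable_of_integral_eq_one' h1).aemeasurable]
  have h := integral_neg_eq_self (fun y => p y * κ y) volume
  simp only [hs, hκ, mul_neg, integral_neg] at h
  linarith

lemma NoiseClass.lintegral_sq_le (hp : p ∈ NoiseClass Υ Ωc ω) :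
    ∫⁻ y, ENNReal.ofReal (y ^ 2) ∂densityLaw p ≤ ENNReal.ofReal 2 *
      ∫⁻ t in Set.Ioi (0 : ℝ), ENNReal.ofReal (2 * (Υ * exp (-Ωc * t ^ ω))) *
        ENNReal.ofReal (t ^ ((2 : ℝ) - 1)) := by
  have h := lintegral_rpow_eq_lintegral_meas_lt_mul (densityLaw p) (f := fun y => |y|)
    (Filter.Eventually.of_forall fun y => abs_nonneg y) (by fun_prop) (p := 2) two_pos
  have h2 : ∀ y : ℝ, |y| ^ (2 : ℝ) = y ^ 2 := fun y => by
    rw [Real.rpow_two, sq_abs]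
  simp only [h2] at h
  rw [h]
  gcongr ENNReal.ofReal 2 * ?_
  refine setLIntegral_mono' measurableSet_Ioi fun t ht => ?_
  gcongr
  exact NoiseClass.tail_le hp (le_of_lt ht)

lemma NoiseClass.moment_bound_lt_top (hΥ : 0 < Υ) (hΩ : 0 < Ωc) (hω : 0 < ω) :
    ENNReal.ofReal 2 *
      ∫⁻ t in Set.Ioi (0 : ℝ), ENNReal.ofReal (2 * (Υ * exp (-Ωc * t ^ ω))) *
        ENNReal.ofReal (t ^ ((2 : ℝ) - 1)) < ⊤ := by
  refine ENNReal.mul_lt_top ENNReal.ofReal_lt_top ?_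
  have hi := (integrableOn_rpow_mul_exp_neg_mul_rpow (s := 2 - 1) (p := ω) (b := Ωc)
    (by norm_num) hω hΩ).const_mul (2 * Υ)
  refine lt_of_eq_of_lt ?_ hi.lintegral_lt_top
  refine setLIntegral_congr_fun measurableSet_Ioi fun t ht => ?_
  rw [← ENNReal.ofReal_mul (by positivity)]
  congr 1
  ring

lemma NoiseClass.integrable_sq (hp : p ∈ NoiseClass Υ Ωc ω)
    (hΥ : 0 < Υ) (hΩ : 0 < Ωc) (hω : 0 < ω) : Integrable (fun y => y ^ 2) (densityLaw p) := by
  refine ⟨by fun_prop, ?_⟩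
  rw [hasFiniteIntegral_iff_ofReal (Filter.Eventually.of_forall fun y => sq_nonneg y)]
  exact (NoiseClass.lintegral_sq_le hp).trans_lt (NoiseClass.moment_bound_lt_top hΥ hΩ hω)

lemma NoiseClass.integral_sq_le_sigma2 {P : Pars} (hp : p ∈ NoiseClass P.Υ P.Ωc P.ω)
    (hΥ : 0 < P.Υ) (hΩ : 0 < P.Ωc) (hω : 0 < P.ω) :
    ∫ y, y ^ 2 ∂densityLaw p ≤ sigma2 P := by
  have key : ∀ q ∈ NoiseClass P.Υ P.Ωc P.ω, ∫ x : ℝ, x ^ 2 * q x = ∫ y, y ^ 2 ∂densityLaw q := by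
    intro q hq
    rw [integral_densityLaw hq.1 (integrable_of_integral_eq_one' hq.2.1).aemeasurable]
    simp only [mul_comm]
  refine le_csSup ⟨ENNReal.toReal (ENNReal.ofReal 2 *
      ∫⁻ t in Set.Ioi (0 : ℝ), ENNReal.ofReal (2 * (P.Υ * exp (-P.Ωc * t ^ P.ω))) *
        ENNReal.ofReal (t ^ ((2 : ℝ) - 1))), ?_⟩ ⟨p, hp, (key p hp).symm⟩
  rintro v ⟨q, hq, rfl⟩
  rw [key q hq, integral_eq_lintegral_of_nonneg_ae
    (Filter.Eventually.of_forall fun y => sq_nonneg y) (by fun_prop)]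
  exact ENNReal.toReal_mono (NoiseClass.moment_bound_lt_top hΥ hΩ hω).ne
    (NoiseClass.lintegral_sq_le hq)

end Noise

/-- Truncation of the noise at level `T`. -/
def trunc (T e : ℝ) : ℝ := if |e| ≤ T then e else 0

lemma measurable_trunc (T : ℝ) : Measurable (trunc T) :=
  Measurable.ite (measurableSet_le (by fun_prop) measurable_const) measurable_id measurable_const

lemma trunc_neg (T y : ℝ) : trunc T (-y) = -trunc T y := by
  unfold trunc
  split_ifs with h h' h' <;> simp_all

lemma abs_trunc_le {T : ℝ} (hT : 0 ≤ T) (y : ℝ) : |trunc T y| ≤ T := by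
  unfold trunc
  split_ifs with h
  · exact h
  · simpa using hT

lemma trunc_sq_le (T y : ℝ) : trunc T y ^ 2 ≤ y ^ 2 := by
  unfold trunc
  split_ifs with h
  · exact le_rfl
  · simpa using sq_nonneg y

namespace KernelHyp

variable {K : ℝ → ℝ} {Q : ℝ}

lemma Q_nonneg (hK : KernelHyp K Q) : 0 ≤ Q := by
  simpa using (abs_nonneg _).trans (hK.lip 1 0)

lemma abs_le_mul (hK : KernelHyp K Q) (u : ℝ) : |K u| ≤ Q * (3 / 2) := by
  by_cases hu : u ∈ Set.Icc (-(1/2) : ℝ) (1/2)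
  · have h1 : K 1 = 0 := hK.supp 1 (by norm_num)
    have h := hK.lip u 1
    rw [h1, sub_zero] at h
    refine h.trans (mul_le_mul_of_nonneg_left ?_ hK.Q_nonneg)
    rw [abs_le]
    constructor <;> linarith [hu.1, hu.2]
  · rw [hK.supp u hu, abs_zero]
    linarith [hK.Q_nonneg]

lemma abs_le_Ksup (hK : KernelHyp K Q) (u : ℝ) : |K u| ≤ Ksup K :=
  le_ciSup (f := fun u => |K u|) ⟨Q * (3 / 2), by rintro _ ⟨u, rfl⟩; exact hK.abs_le_mul u⟩ u

lemma continuous (hK : KernelHyp K Q) : Continuous K := by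
  refine (LipschitzWith.of_dist_le_mul (K := ⟨Q, hK.Q_nonneg⟩) fun u v => ?_).continuous
  rw [Real.dist_eq, Real.dist_eq]
  exact hK.lip u v

lemma hasCompactSupport (hK : KernelHyp K Q) : HasCompactSupport K :=
  HasCompactSupport.intro isCompact_Icc hK.supp

lemma integral_comp_le {ψ : ℝ → ℝ} {c : ℝ} (hi : Integrable ψ)
    (hψ0 : ∀ u : ℝ, u ∉ Set.Icc (-(1/2) : ℝ) (1/2) → ψ u = 0) (hψc : ∀ u, ψ u ≤ c) :
    ∫ u, ψ u ≤ c := by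
  have h : ∫ u, ψ u = ∫ u in Set.Icc (-(1/2) : ℝ) (1/2), ψ u :=
    (setIntegral_eq_integral_of_forall_compl_eq_zero hψ0).symm
  rw [h]
  refine (setIntegral_mono hi.integrableOn (integrableOn_const (C := c) (by simp)) hψc).trans ?_
  rw [setIntegral_const, measureReal_def, Real.volume_Icc]
  norm_num

lemma one_le_Ksup (hK : KernelHyp K Q) : 1 ≤ Ksup K := by
  rw [← hK.norm_one]
  exact integral_comp_le (hK.continuous.integrable_of_hasCompactSupport hK.hasCompactSupport)
    hK.supp fun u => (le_abs_self _).trans (hK.abs_le_Ksup u)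

lemma one_le_mul_Q (hK : KernelHyp K Q) : 1 ≤ Q * (3 / 2) :=
  hK.one_le_Ksup.trans (ciSup_le hK.abs_le_mul)

end KernelHyp

/-- The rescaled product kernel centred at `v`. -/
def scaledK (K : ℝ → ℝ) (h : ℝ) (v x : Fin 2 → ℝ) : ℝ :=
  h ^ (-2 : ℤ) * K ((x 0 - v 0) / h) * K ((x 1 - v 1) / h)

lemma integrable_prod_rescaled {ψ : ℝ → ℝ} (hψ : Integrable ψ) {h : ℝ} (hh : 0 < h)
    (v : Fin 2 → ℝ) :
    Integrable fun x : Fin 2 → ℝ => ψ ((x 0 - v 0) / h) * ψ ((x 1 - v 1) / h) := by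
  have h1 : ∀ i, Integrable fun t : ℝ => ψ ((t - v i) / h) := fun i =>
    (hψ.comp_div hh.ne').comp_sub_right (v i)
  have := Integrable.fintype_prod (μ := fun _ : Fin 2 => (volume : Measure ℝ))
    (f := fun i t => ψ ((t - v i) / h)) h1
  simpa [Fin.prod_univ_two, volume_pi] using this

lemma integral_prod_rescaled (ψ : ℝ → ℝ) {h : ℝ} (hh : 0 < h) (v : Fin 2 → ℝ) :
    ∫ x : Fin 2 → ℝ, ψ ((x 0 - v 0) / h) * ψ ((x 1 - v 1) / h) = h ^ 2 * (∫ u, ψ u) ^ 2 := by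
  have h0 := integral_fintype_prod_volume_eq_prod (fun (i : Fin 2) (t : ℝ) => ψ ((t - v i) / h))
  have h1 : ∀ i, ∫ t : ℝ, ψ ((t - v i) / h) = h * ∫ u, ψ u := fun i => by
    rw [integral_sub_right_eq_self (fun t => ψ (t / h)) (v i), Measure.integral_comp_div,
      abs_of_pos hh, smul_eq_mul]
  simp only [Fin.prod_univ_two, h1] at h0
  rw [h0]
  ring

namespace KernelHyp

variable {K : ℝ → ℝ} {Q : ℝ} {h : ℝ}

lemma continuous_scaledK (hK : KernelHyp K Q) (h : ℝ) (v : Fin 2 → ℝ) :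
    Continuous (scaledK K h v) := by
  have := hK.continuous
  unfold scaledK
  fun_prop

lemma abs_sub_le_of_scaledK_ne_zero (hK : KernelHyp K Q) (hh : 0 < h) {v x : Fin 2 → ℝ}
    (hne : scaledK K h v x ≠ 0) (k : Fin 2) : |x k - v k| ≤ h / 2 := by
  have key : ∀ t : ℝ, K (t / h) ≠ 0 → |t| ≤ h / 2 := fun t ht => by
    by_contra hc
    refine ht (hK.supp _ fun hm => hc ?_)
    rw [Set.mem_Icc, le_div_iff₀ hh, div_le_iff₀ hh] at hm
    rw [abs_le]
    constructor <;> linarith [hm.1, hm.2]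
  unfold scaledK at hne
  fin_cases k
  · exact key _ (right_ne_zero_of_mul (left_ne_zero_of_mul hne))
  · exact key _ (right_ne_zero_of_mul hne)

lemma abs_scaledK_le (hK : KernelHyp K Q) (v x : Fin 2 → ℝ) :
    |scaledK K h v x| ≤ (h ^ 2)⁻¹ * Ksup K ^ 2 := by
  have h0 : 0 ≤ Ksup K := zero_le_one.trans hK.one_le_Ksup
  unfold scaledK
  rw [abs_mul, abs_mul, mul_assoc, zpow_neg, abs_of_nonneg (inv_nonneg.2 (by positivity))]
  rw [sq (Ksup K)]
  norm_cast
  gcongr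
  · exact hK.abs_le_Ksup _
  · exact hK.abs_le_Ksup _

lemma integrable_scaledK (hK : KernelHyp K Q) (hh : 0 < h) (v : Fin 2 → ℝ) :
    Integrable (scaledK K h v) := by
  have := (integrable_prod_rescaled
    (hK.continuous.integrable_of_hasCompactSupport hK.hasCompactSupport) hh v).const_mul
      (h ^ (-2 : ℤ))
  refine this.congr (Filter.Eventually.of_forall fun x => ?_)
  simp only [scaledK, mul_assoc]

lemma integral_scaledK (hK : KernelHyp K Q) (hh : 0 < h) (v : Fin 2 → ℝ) :
    ∫ x, scaledK K h v x = 1 := by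
  simp only [scaledK, mul_assoc]
  rw [integral_const_mul, integral_prod_rescaled K hh, hK.norm_one, one_pow, zpow_neg]
  norm_cast
  field_simp

lemma integral_abs_scaledK (hh : 0 < h) (v : Fin 2 → ℝ) :
    ∫ x, |scaledK K h v x| = K1 K ^ 2 := by
  have : ∀ x, |scaledK K h v x| =
      h ^ (-2 : ℤ) * (|K ((x 0 - v 0) / h)| * |K ((x 1 - v 1) / h)|) := fun x => by
    rw [scaledK, abs_mul, abs_mul, mul_assoc, abs_of_pos (zpow_pos hh _)]
  simp only [this]
  rw [integral_const_mul, integral_prod_rescaled (fun u => |K u|) hh, K1, zpow_neg]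
  norm_cast
  field_simp

lemma integrable_sq (hK : KernelHyp K Q) : Integrable fun u => K u ^ 2 := by
  refine (hK.continuous.pow 2).integrable_of_hasCompactSupport ?_
  refine HasCompactSupport.intro isCompact_Icc (K := Set.Icc (-(1/2) : ℝ) (1/2)) fun u hu => ?_
  simp [hK.supp u hu]

lemma scaledK_sq (v x : Fin 2 → ℝ) : scaledK K h v x ^ 2 =
    (h ^ 4)⁻¹ * (K ((x 0 - v 0) / h) ^ 2 * K ((x 1 - v 1) / h) ^ 2) := by
  rw [scaledK, zpow_neg]
  norm_cast
  rw [mul_pow, mul_pow, inv_pow, ← pow_mul]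
  ring

lemma integrable_scaledK_sq (hK : KernelHyp K Q) (hh : 0 < h) (v : Fin 2 → ℝ) :
    Integrable fun x => scaledK K h v x ^ 2 := by
  simp only [scaledK_sq]
  exact (integrable_prod_rescaled hK.integrable_sq hh v).const_mul _

lemma integral_scaledK_sq_le (hK : KernelHyp K Q) (hh : 0 < h) (v : Fin 2 → ℝ) :
    ∫ x, scaledK K h v x ^ 2 ≤ (h ^ 2)⁻¹ * Ksup K ^ 4 := by
  have h1 : ∫ u, K u ^ 2 ≤ Ksup K ^ 2 := integral_comp_le hK.integrable_sq
    (fun u hu => by simp [hK.supp u hu]) fun u => by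
      rw [← sq_abs]
      exact pow_le_pow_left₀ (abs_nonneg _) (hK.abs_le_Ksup u) 2
  have h2 : 0 ≤ ∫ u, K u ^ 2 := integral_nonneg fun u => sq_nonneg _
  simp only [scaledK_sq]
  rw [integral_const_mul, integral_prod_rescaled (fun u => K u ^ 2) hh]
  have : (h ^ 4)⁻¹ * (h ^ 2 * (∫ u, K u ^ 2) ^ 2) = (h ^ 2)⁻¹ * (∫ u, K u ^ 2) ^ 2 := by
    field_simp
  rw [this, show Ksup K ^ 4 = (Ksup K ^ 2) ^ 2 by ring]
  gcongr

lemma abs_scaledK_sub_le (hK : KernelHyp K Q) (hh : 0 < h) {v w : Fin 2 → ℝ} {δ : ℝ}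
    (hvw : ∀ k, |v k - w k| ≤ δ) (x : Fin 2 → ℝ) :
    |scaledK K h v x - scaledK K h w x| ≤ (h ^ 2)⁻¹ * (2 * Ksup K * (Q * (δ / h))) := by
  have key : ∀ k, |K ((x k - v k) / h) - K ((x k - w k) / h)| ≤ Q * (δ / h) := fun k => by
    refine (hK.lip _ _).trans (mul_le_mul_of_nonneg_left ?_ hK.Q_nonneg)
    rw [← sub_div, abs_div, abs_of_pos hh]
    gcongr
    rw [show x k - v k - (x k - w k) = -(v k - w k) by ring, abs_neg]
    exact hvw k
  have e : scaledK K h v x - scaledK K h w x = (h ^ 2)⁻¹ *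
      ((K ((x 0 - v 0) / h) - K ((x 0 - w 0) / h)) * K ((x 1 - v 1) / h) +
        K ((x 0 - w 0) / h) * (K ((x 1 - v 1) / h) - K ((x 1 - w 1) / h))) := by
    rw [scaledK, scaledK, zpow_neg]
    norm_cast
    ring
  rw [e, abs_mul, abs_of_nonneg (by positivity)]
  gcongr
  refine (abs_add_le _ _).trans ?_
  rw [abs_mul, abs_mul]
  have h0 : 0 ≤ Ksup K := zero_le_one.trans hK.one_le_Ksup
  have hd : 0 ≤ Q * (δ / h) := (abs_nonneg _).trans (key 0)
  have a1 := mul_le_mul (key 0) (hK.abs_le_Ksup ((x 1 - v 1) / h)) (abs_nonneg _) hd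
  have a2 := mul_le_mul (hK.abs_le_Ksup ((x 0 - w 0) / h)) (key 1) (abs_nonneg _) h0
  linarith

end KernelHyp

/-- The square `[-5/2, 5/2]²`. -/
abbrev square : Set (Fin 2 → ℝ) :=
  Set.Icc (fun _ : Fin 2 => -(5/2 : ℝ)) (fun _ : Fin 2 => (5/2 : ℝ))

/-- Contribution of one observation to the auxiliary estimator, with truncated noise. -/
def truncObs (K : ℝ → ℝ) (g F : (Fin 2 → ℝ) → ℝ) (h T : ℝ) (v : Fin 2 → ℝ)
    (z : (Fin 2 → ℝ) × ℝ) : ℝ :=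
  (g z.1)⁻¹ * scaledK K h v z.1 * (F z.1 + trunc T (z.2 - F z.1))

section

variable {K : ℝ → ℝ} {Q : ℝ} {g F : (Fin 2 → ℝ) → ℝ} {p : ℝ → ℝ} {gl h T Φ : ℝ}
  {v w : Fin 2 → ℝ}

lemma DesignOK.le_of_scaledK_ne_zero (hg : DesignOK g gl) (hK : KernelHyp K Q) (hh : 0 < h)
    (hh1 : h ≤ 1) (hv : v ∈ square) {x : Fin 2 → ℝ} (hne : scaledK K h v x ≠ 0) : gl ≤ g x := by
  have hx := fun k => abs_le.1 (hK.abs_sub_le_of_scaledK_ne_zero hh hne k)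
  refine hg.2.2 x ⟨fun k => ?_, fun k => ?_⟩
  · have := hv.1 k
    simp only at this ⊢
    linarith [(hx k).1]
  · have := hv.2 k
    simp only at this ⊢
    linarith [(hx k).2]

lemma DesignOK.abs_inv_mul_scaledK_le (hg : DesignOK g gl) (hgl : 0 < gl) (hK : KernelHyp K Q)
    (hh : 0 < h) (hh1 : h ≤ 1) (hv : v ∈ square) (x : Fin 2 → ℝ) :
    |(g x)⁻¹ * scaledK K h v x| ≤ gl⁻¹ * ((h ^ 2)⁻¹ * Ksup K ^ 2) := by
  by_cases hne : scaledK K h v x = 0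
  · rw [hne, mul_zero, abs_zero]
    positivity
  · rw [abs_mul, abs_of_nonneg (inv_nonneg.2 (hg.1 x))]
    have := hg.le_of_scaledK_ne_zero hK hh hh1 hv hne
    gcongr
    exact hK.abs_scaledK_le v x

lemma abs_truncObs_le (hg : DesignOK g gl) (hgl : 0 < gl) (hK : KernelHyp K Q)
    (hh : 0 < h) (hh1 : h ≤ 1) (hv : v ∈ square) (hT : 0 ≤ T) (hΦ0 : 0 ≤ Φ)
    (hΦ : ∀ x, (∀ k, |x k - v k| ≤ h / 2) → |F x| ≤ Φ) (z : (Fin 2 → ℝ) × ℝ) :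
    |truncObs K g F h T v z| ≤ (Φ + T) * (gl⁻¹ * ((h ^ 2)⁻¹ * Ksup K ^ 2)) := by
  unfold truncObs
  by_cases hne : scaledK K h v z.1 = 0
  · rw [hne, mul_zero, zero_mul, abs_zero]
    positivity
  · rw [abs_mul, mul_comm]
    gcongr
    · exact (abs_add_le _ _).trans (add_le_add
        (hΦ _ (hK.abs_sub_le_of_scaledK_ne_zero hh hne)) (abs_trunc_le hT _))
    · exact hg.abs_inv_mul_scaledK_le hgl hK hh hh1 hv z.1

lemma abs_truncObs_sub_le (hg : DesignOK g gl) (hgl : 0 < gl) (hK : KernelHyp K Q)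
    (hh : 0 < h) (hh1 : h ≤ 1) (hv : v ∈ square) (hw : w ∈ square) (hT : 0 ≤ T) (hΦ0 : 0 ≤ Φ)
    (hΦ : ∀ u ∈ square, ∀ x, (∀ k, |x k - u k| ≤ h / 2) → |F x| ≤ Φ) {δ : ℝ}
    (hvw : ∀ k, |v k - w k| ≤ δ) (z : (Fin 2 → ℝ) × ℝ) :
    |truncObs K g F h T v z - truncObs K g F h T w z| ≤
      (Φ + T) * (gl⁻¹ * ((h ^ 2)⁻¹ * (2 * Ksup K * (Q * (δ / h))))) := by
  have hδ : 0 ≤ δ := (abs_nonneg _).trans (hvw 0)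
  have hQ := hK.Q_nonneg
  have hS : 0 ≤ Ksup K := zero_le_one.trans hK.one_le_Ksup
  have e : truncObs K g F h T v z - truncObs K g F h T w z =
      (F z.1 + trunc T (z.2 - F z.1)) *
        ((g z.1)⁻¹ * (scaledK K h v z.1 - scaledK K h w z.1)) := by
    unfold truncObs; ring
  have hmain : (gl ≤ g z.1 ∧ |F z.1| ≤ Φ) → |truncObs K g F h T v z - truncObs K g F h T w z| ≤
      (Φ + T) * (gl⁻¹ * ((h ^ 2)⁻¹ * (2 * Ksup K * (Q * (δ / h))))) := by
    rintro ⟨h1, h2⟩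
    rw [e, abs_mul, abs_mul, abs_of_nonneg (inv_nonneg.2 (hg.1 _))]
    gcongr
    · exact mul_nonneg (inv_nonneg.2 (hg.1 _)) (abs_nonneg _)
    · exact (abs_add_le _ _).trans (add_le_add h2 (abs_trunc_le hT _))
    · exact hK.abs_scaledK_sub_le hh hvw _
  by_cases hv0 : scaledK K h v z.1 = 0
  · by_cases hw0 : scaledK K h w z.1 = 0
    · rw [e, hv0, hw0, sub_zero, mul_zero, mul_zero, abs_zero]
      positivity
    · exact hmain ⟨hg.le_of_scaledK_ne_zero hK hh hh1 hw hw0,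
        hΦ w hw _ (hK.abs_sub_le_of_scaledK_ne_zero hh hw0)⟩
  · exact hmain ⟨hg.le_of_scaledK_ne_zero hK hh hh1 hv hv0,
        hΦ v hv _ (hK.abs_sub_le_of_scaledK_ne_zero hh hv0)⟩

lemma aestronglyMeasurable_truncObs (hg : AEMeasurable g) (hK : KernelHyp K Q)
    (hF : Measurable F) :
    AEStronglyMeasurable (truncObs K g F h T v) (jointLaw g p F) := by
  refine AEStronglyMeasurable.mono_ac (withDensity_absolutelyContinuous _ _)
    (AEMeasurable.aestronglyMeasurable ?_)
  have h1 : AEMeasurable (fun z : (Fin 2 → ℝ) × ℝ => g z.1) :=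
    hg.comp_quasiMeasurePreserving Measure.quasiMeasurePreserving_fst
  have h2 := (hK.continuous_scaledK h v).measurable
  have h3 := measurable_trunc T
  unfold truncObs
  refine (h1.inv.mul ?_).mul ?_
  · exact (h2.comp measurable_fst).aemeasurable
  · exact ((hF.comp measurable_fst).add
      (h3.comp (measurable_snd.sub (hF.comp measurable_fst)))).aemeasurable

variable {P : Pars}

lemma aestronglyMeasurable_weight (hg : DesignOK g gl) (hK : KernelHyp K Q) :
    AEStronglyMeasurable (fun x => (g x)⁻¹ * scaledK K h v x) (densityLaw g) :=
  aestronglyMeasurable_densityLaw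
    ((integrable_of_integral_eq_one' hg.2.1).aemeasurable.inv.mul
      (hK.continuous_scaledK h v).measurable.aemeasurable).aestronglyMeasurable

lemma integrable_weight_mul (hg : DesignOK g gl) (hgl : 0 < gl) (hK : KernelHyp K Q)
    (hh : 0 < h) (hh1 : h ≤ 1) (hv : v ∈ square) (hF : Measurable F)
    (hΦ : ∀ x, (∀ k, |x k - v k| ≤ h / 2) → |F x| ≤ Φ) :
    Integrable (fun x => (g x)⁻¹ * scaledK K h v x * F x) (densityLaw g) := by
  have := isProbabilityMeasure_densityLaw hg.1 hg.2.1
  refine Integrable.of_bound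
    ((aestronglyMeasurable_weight hg hK).mul hF.aestronglyMeasurable)
    (gl⁻¹ * ((h ^ 2)⁻¹ * Ksup K ^ 2) * Φ) (Filter.Eventually.of_forall fun x => ?_)
  rw [Real.norm_eq_abs, abs_mul]
  by_cases hne : scaledK K h v x = 0
  · have h0 : |F v| ≤ Φ := hΦ v fun k => by rw [sub_self, abs_zero]; positivity
    have : 0 ≤ Φ := (abs_nonneg _).trans h0
    rw [hne, mul_zero, abs_zero, zero_mul]
    positivity
  · gcongr
    · exact hg.abs_inv_mul_scaledK_le hgl hK hh hh1 hv x
    · exact hΦ _ (hK.abs_sub_le_of_scaledK_ne_zero hh hne)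

lemma integral_truncObs (hg : DesignOK g gl) (hgl : 0 < gl) (hK : KernelHyp K Q)
    (hh : 0 < h) (hh1 : h ≤ 1) (hv : v ∈ square) (hT : 0 ≤ T) (hF : Measurable F)
    (hΦ : ∀ x, (∀ k, |x k - v k| ≤ h / 2) → |F x| ≤ Φ)
    (hp : p ∈ NoiseClass P.Υ P.Ωc P.ω) :
    ∫ z, truncObs K g F h T v z ∂jointLaw g p F = ∫ x, scaledK K h v x * F x := by
  have hgm := (integrable_of_integral_eq_one' hg.2.1).aemeasurable
  have hpm := (integrable_of_integral_eq_one' hp.2.1).aemeasurable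
  have i1 := isProbabilityMeasure_densityLaw hg.1 hg.2.1
  have i2 := isProbabilityMeasure_densityLaw hp.1 hp.2.1
  have hae := aestronglyMeasurable_truncObs (h := h) (T := T) (v := v) (p := p) hgm hK hF
  rw [jointLaw_eq_map hgm hpm hg.1 hF] at hae ⊢
  rw [integral_map (by fun_prop) hae]
  have e : ∀ z : (Fin 2 → ℝ) × ℝ, truncObs K g F h T v (z.1, F z.1 + z.2) =
      (g z.1)⁻¹ * scaledK K h v z.1 * F z.1 + (g z.1)⁻¹ * scaledK K h v z.1 * trunc T z.2 :=
    fun z => by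
      unfold truncObs
      simp only [add_sub_cancel_left]
      ring
  simp only [e]
  have hT1 : Integrable (trunc T) (densityLaw p) :=
    Integrable.of_bound (measurable_trunc T).aestronglyMeasurable T
      (Filter.Eventually.of_forall fun y => abs_trunc_le hT y)
  have hw1 : Integrable (fun x => (g x)⁻¹ * scaledK K h v x) (densityLaw g) := by
    simpa using integrable_weight_mul (F := fun _ => (1 : ℝ)) (Φ := 1) hg hgl hK hh hh1 hv
      measurable_const fun _ _ => by simp
  have hwF := integrable_weight_mul hg hgl hK hh hh1 hv hF hΦ
  change ∫ z, _ ∂((densityLaw g).prod (densityLaw p)) = _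
  rw [integral_add (hwF.comp_fst (densityLaw p)) (hw1.mul_prod hT1),
    integral_prod_mul (fun x => (g x)⁻¹ * scaledK K h v x) (trunc T),
    NoiseClass.integral_odd hp (trunc_neg T), mul_zero, add_zero,
    integral_fun_fst (fun x => (g x)⁻¹ * scaledK K h v x * F x), probReal_univ, one_smul,
    integral_densityLaw hg.1 hgm]
  refine integral_congr_ae (Filter.Eventually.of_forall fun x => ?_)
  simp only
  by_cases hne : scaledK K h v x = 0
  · simp [hne]
  · have := hgl.trans_le (hg.le_of_scaledK_ne_zero hK hh hh1 hv hne)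
    field_simp

lemma integral_weight_sq_le (hg : DesignOK g gl) (hgl : 0 < gl) (hK : KernelHyp K Q)
    (hh : 0 < h) (hh1 : h ≤ 1) (hv : v ∈ square) :
    ∫ x, ((g x)⁻¹ * scaledK K h v x) ^ 2 ∂densityLaw g ≤
      gl⁻¹ * ((h ^ 2)⁻¹ * Ksup K ^ 4) := by
  have hgm := (integrable_of_integral_eq_one' hg.2.1).aemeasurable
  rw [integral_densityLaw hg.1 hgm]
  calc _ ≤ ∫ x, gl⁻¹ * scaledK K h v x ^ 2 := by
        refine integral_mono_of_nonneg
          (Filter.Eventually.of_forall fun x => mul_nonneg (hg.1 x) (sq_nonneg _))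
          ((hK.integrable_scaledK_sq hh v).const_mul _) (Filter.Eventually.of_forall fun x => ?_)
        simp only
        by_cases hne : scaledK K h v x = 0
        · simp [hne]
        · have h1 := hg.le_of_scaledK_ne_zero hK hh hh1 hv hne
          have h2 := hgl.trans_le h1
          have : g x * ((g x)⁻¹ * scaledK K h v x) ^ 2 = (g x)⁻¹ * scaledK K h v x ^ 2 := by
            field_simp
          rw [this]
          gcongr
    _ = gl⁻¹ * ∫ x, scaledK K h v x ^ 2 := integral_const_mul _ _
    _ ≤ _ := by
        have := hK.integral_scaledK_sq_le hh v
        gcongr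

lemma integral_truncObs_sq_le (hg : DesignOK g gl) (hgl : 0 < gl) (hK : KernelHyp K Q)
    (hh : 0 < h) (hh1 : h ≤ 1) (hv : v ∈ square) (hF : Measurable F)
    (hΦ : ∀ x, (∀ k, |x k - v k| ≤ h / 2) → |F x| ≤ Φ)
    (hp : p ∈ NoiseClass P.Υ P.Ωc P.ω) (hΥ : 0 < P.Υ) (hΩ : 0 < P.Ωc) (hω : 0 < P.ω) :
    ∫ z, truncObs K g F h T v z ^ 2 ∂jointLaw g p F ≤
      2 * (Φ ^ 2 + sigma2 P) * (gl⁻¹ * ((h ^ 2)⁻¹ * Ksup K ^ 4)) := by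
  have hgm := (integrable_of_integral_eq_one' hg.2.1).aemeasurable
  have hpm := (integrable_of_integral_eq_one' hp.2.1).aemeasurable
  have i1 := isProbabilityMeasure_densityLaw hg.1 hg.2.1
  have i2 := isProbabilityMeasure_densityLaw hp.1 hp.2.1
  have hae : AEStronglyMeasurable (fun z => truncObs K g F h T v z ^ 2) (jointLaw g p F) :=
    (aestronglyMeasurable_truncObs hgm hK hF).pow 2
  rw [jointLaw_eq_map hgm hpm hg.1 hF] at hae ⊢
  rw [integral_map (by fun_prop) hae]
  have hw2 : Integrable (fun x => ((g x)⁻¹ * scaledK K h v x) ^ 2) (densityLaw g) := by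
    refine Integrable.of_bound ((aestronglyMeasurable_weight hg hK).pow 2)
      ((gl⁻¹ * ((h ^ 2)⁻¹ * Ksup K ^ 2)) ^ 2) (Filter.Eventually.of_forall fun x => ?_)
    rw [norm_pow]
    exact pow_le_pow_left₀ (norm_nonneg _) (hg.abs_inv_mul_scaledK_le hgl hK hh hh1 hv x) 2
  have hsq := NoiseClass.integrable_sq hp hΥ hΩ hω
  change ∫ z, _ ∂((densityLaw g).prod (densityLaw p)) ≤ _
  calc _ ≤ ∫ z : (Fin 2 → ℝ) × ℝ, (2 * Φ ^ 2 * ((g z.1)⁻¹ * scaledK K h v z.1) ^ 2 +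
        2 * (((g z.1)⁻¹ * scaledK K h v z.1) ^ 2 * z.2 ^ 2))
          ∂((densityLaw g).prod (densityLaw p)) := by
        refine integral_mono_of_nonneg (Filter.Eventually.of_forall fun z => sq_nonneg _)
          (((hw2.const_mul (2 * Φ ^ 2)).comp_fst (densityLaw p)).add
            ((hw2.mul_prod hsq).const_mul 2)) (Filter.Eventually.of_forall fun z => ?_)
        simp only [truncObs, add_sub_cancel_left, mul_pow _ (_ + _)]
        set a := ((g z.1)⁻¹ * scaledK K h v z.1) ^ 2 with ha
        have ha0 : 0 ≤ a := sq_nonneg _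
        have h1 : a * F z.1 ^ 2 ≤ a * Φ ^ 2 := by
          by_cases hne : scaledK K h v z.1 = 0
          · simp [ha, hne]
          · refine mul_le_mul_of_nonneg_left ?_ ha0
            rw [← sq_abs (F z.1)]
            exact pow_le_pow_left₀ (abs_nonneg _)
              (hΦ _ (hK.abs_sub_le_of_scaledK_ne_zero hh hne)) 2
        have h2 : a * trunc T z.2 ^ 2 ≤ a * z.2 ^ 2 :=
          mul_le_mul_of_nonneg_left (trunc_sq_le _ _) ha0
        have h3 : 0 ≤ a * (F z.1 - trunc T z.2) ^ 2 := mul_nonneg ha0 (sq_nonneg _)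
        nlinarith
    _ = 2 * Φ ^ 2 * ∫ x, ((g x)⁻¹ * scaledK K h v x) ^ 2 ∂densityLaw g +
        2 * ((∫ x, ((g x)⁻¹ * scaledK K h v x) ^ 2 ∂densityLaw g) *
          ∫ y, y ^ 2 ∂densityLaw p) := by
        rw [integral_add ((hw2.const_mul (2 * Φ ^ 2)).comp_fst (densityLaw p))
          ((hw2.mul_prod hsq).const_mul 2), integral_const_mul 2,
          integral_prod_mul (fun x => ((g x)⁻¹ * scaledK K h v x) ^ 2) (fun y : ℝ => y ^ 2),
          integral_fun_fst (fun x => 2 * Φ ^ 2 * ((g x)⁻¹ * scaledK K h v x) ^ 2), probReal_univ,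
          one_smul, integral_const_mul]
    _ = 2 * (Φ ^ 2 + ∫ y, y ^ 2 ∂densityLaw p) *
        ∫ x, ((g x)⁻¹ * scaledK K h v x) ^ 2 ∂densityLaw g := by ring
    _ ≤ _ := by
        have h1 := integral_weight_sq_le hg hgl hK hh hh1 hv
        have h2 := NoiseClass.integral_sq_le_sigma2 hp hΥ hΩ hω
        have h3 : 0 ≤ ∫ y, y ^ 2 ∂densityLaw p := integral_nonneg fun y => sq_nonneg y
        have h4 : 0 ≤ ∫ x, ((g x)⁻¹ * scaledK K h v x) ^ 2 ∂densityLaw g :=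
          integral_nonneg fun y => sq_nonneg _
        have h5 : 0 ≤ sigma2 P := h3.trans h2
        gcongr

lemma isProbabilityMeasure_jointLaw (hg : DesignOK g gl) (hF : Measurable F)
    (hp : p ∈ NoiseClass P.Υ P.Ωc P.ω) : IsProbabilityMeasure (jointLaw g p F) := by
  have i1 := isProbabilityMeasure_densityLaw hg.1 hg.2.1
  have i2 := isProbabilityMeasure_densityLaw hp.1 hp.2.1
  rw [jointLaw_eq_map (integrable_of_integral_eq_one' hg.2.1).aemeasurable
    (integrable_of_integral_eq_one' hp.2.1).aemeasurable hg.1 hF]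
  change IsProbabilityMeasure (Measure.map _ ((densityLaw g).prod (densityLaw p)))
  exact Measure.isProbabilityMeasure_map (by fun_prop)

lemma jointLaw_noise_tail_le (hg : DesignOK g gl) (hF : Measurable F)
    (hp : p ∈ NoiseClass P.Υ P.Ωc P.ω) (hT : 0 ≤ T) :
    jointLaw g p F {z | T < |z.2 - F z.1|} ≤
      ENNReal.ofReal (2 * (P.Υ * exp (-P.Ωc * T ^ P.ω))) := by
  have i1 := isProbabilityMeasure_densityLaw hg.1 hg.2.1
  have i2 := isProbabilityMeasure_densityLaw hp.1 hp.2.1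
  have hm : MeasurableSet {z : (Fin 2 → ℝ) × ℝ | T < |z.2 - F z.1|} :=
    measurableSet_lt measurable_const (by fun_prop)
  rw [jointLaw_eq_map (integrable_of_integral_eq_one' hg.2.1).aemeasurable
    (integrable_of_integral_eq_one' hp.2.1).aemeasurable hg.1 hF,
    Measure.map_apply (by fun_prop) hm]
  change ((densityLaw g).prod (densityLaw p)) _ ≤ _
  have : (fun z : (Fin 2 → ℝ) × ℝ => (z.1, F z.1 + z.2)) ⁻¹' {z | T < |z.2 - F z.1|} =
      Set.univ ×ˢ {y : ℝ | T < |y|} := by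
    ext z
    simp
  rw [this, Measure.prod_prod, measure_univ, one_mul]
  exact NoiseClass.tail_le hp hT

lemma abs_integral_scaledK_mul_sub_le (hK : KernelHyp K Q) (hh : 0 < h) (hF : Continuous F)
    (hb : ∀ x, (∀ k, |x k - v k| ≤ h / 2) → |F x - F v| ≤ 1) :
    |(∫ x, scaledK K h v x * F x) - F v| ≤ K1 K ^ 2 := by
  have hle : ∀ x, |scaledK K h v x * (F x - F v)| ≤ |scaledK K h v x| := fun x => by
    by_cases hne : scaledK K h v x = 0
    · simp [hne]
    · rw [abs_mul]
      exact mul_le_of_le_one_right (abs_nonneg _)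
        (hb x (hK.abs_sub_le_of_scaledK_ne_zero hh hne))
  have hi := hK.integrable_scaledK hh v
  have hi2 : Integrable fun x => scaledK K h v x * (F x - F v) :=
    hi.abs.mono' (by
      have := hK.continuous_scaledK h v
      exact Continuous.aestronglyMeasurable (by fun_prop)) (Filter.Eventually.of_forall hle)
  have e : (∫ x, scaledK K h v x * F x) - F v = ∫ x, scaledK K h v x * (F x - F v) := by
    have h1 : ∀ x, scaledK K h v x * F x =
        scaledK K h v x * (F x - F v) + scaledK K h v x * F v := fun x => by ring
    simp only [h1]
    rw [integral_add hi2 (hi.mul_const _), integral_mul_const, hK.integral_scaledK hh]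
    ring
  rw [e, ← KernelHyp.integral_abs_scaledK hh v]
  exact (abs_integral_le_integral_abs).trans (integral_mono hi2.abs hi.abs hle)

end

section

open Filter Topology

lemma nat_mul_frakh_sq (ω : ℝ) {n : ℕ} (hn : 1 ≤ n) :
    (n : ℝ) * frakh ω n ^ 2 = log n ^ (1 + 1 / ω) := by
  have hn' : (0 : ℝ) < n := by positivity
  have hL : 0 ≤ log n := log_natCast_nonneg n
  rw [frakh, sq_sqrt (by positivity), mul_inv_cancel_left₀ hn'.ne']

lemma tendsto_log_natCast : Tendsto (fun n : ℕ => log n) atTop atTop :=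
  tendsto_log_atTop.comp tendsto_natCast_atTop_atTop

lemma tendsto_inv_mul_log_rpow (b : ℝ) :
    Tendsto (fun n : ℕ => (n : ℝ)⁻¹ * log n ^ b) atTop (𝓝 0) := by
  have h := (isLittleO_log_rpow_rpow_atTop b (s := 1) one_pos).tendsto_div_nhds_zero
  refine (h.comp tendsto_natCast_atTop_atTop).congr fun n => ?_
  simp only [Function.comp_apply, rpow_one, div_eq_inv_mul]

lemma exists_forall_of_eventually_atTop {p : ℕ → Prop} (h : ∀ᶠ n in atTop, p n) :
    ∃ m : ℕ, 1 ≤ m ∧ ∀ n, m ≤ n → p n := by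
  obtain ⟨m, hm⟩ := eventually_atTop.1 h
  exact ⟨max m 1, le_max_right _ _, fun n hn => hm n ((le_max_left _ _).trans hn)⟩

lemma tendsto_frakh_rpow {β ω : ℝ} (hβ : 0 < β) :
    Tendsto (fun n : ℕ => frakh ω n ^ β) atTop (𝓝 0) := by
  have h1 : Tendsto (fun n : ℕ => frakh ω n) atTop (𝓝 0) := by
    have := (tendsto_inv_mul_log_rpow (1 + 1 / ω)).sqrt
    rwa [sqrt_zero] at this
  have := h1.rpow_const (p := β) (Or.inr hβ.le)
  rwa [zero_rpow hβ.ne'] at this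

lemma tendsto_log_rpow_mul_hmin_rpow {β ω : ℝ} (hβ : 0 < β) :
    Tendsto (fun n : ℕ => log n ^ (1 / ω) * hmin ω n ^ β) atTop (𝓝 0) := by
  have := (tendsto_inv_mul_log_rpow (1 + 2 / ω + 1 / ω / β)).rpow_const (p := β) (Or.inr hβ.le)
  rw [zero_rpow hβ.ne'] at this
  refine this.congr' ?_
  filter_upwards [eventually_ge_atTop 2] with n hn
  have hn' : (1 : ℝ) < n := by exact_mod_cast hn
  have hL : 0 < log n := log_pos hn'
  rw [hmin, rpow_add hL, ← mul_assoc, mul_rpow (by positivity) (by positivity) (z := β),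
    ← rpow_mul hL.le (1 / ω / β), div_mul_cancel₀ _ hβ.ne', mul_comm]

lemma n0_spec {β₀ M ω : ℝ} (hβ : 0 < β₀) {n : ℕ} (hn : n0 β₀ M ω ≤ n) :
    1 ≤ n ∧ max M 1 * frakh ω n ^ β₀ ≤ 1 := by
  have ht : Tendsto (fun n : ℕ => max M 1 *
      max (frakh ω n ^ β₀) (log n ^ (1 / ω) * hmin ω n ^ β₀)) atTop (𝓝 0) := by
    have := ((tendsto_frakh_rpow (ω := ω) hβ).max
      (tendsto_log_rpow_mul_hmin_rpow (ω := ω) hβ)).const_mul (max M 1)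
    rwa [max_self, mul_zero] at this
  obtain ⟨h1, h2⟩ := Nat.sInf_mem
    (exists_forall_of_eventually_atTop (ht.eventually_le_const one_pos))
  refine ⟨h1.trans hn, le_trans ?_ (h2 n hn)⟩
  gcongr
  exact le_max_left _ _

lemma tendsto_c3f_mul_inv {P : Pars} (hω : 0 < P.ω) (hQ : 0 < P.Q) (hgl : 0 < P.gl) :
    Tendsto (fun n : ℕ => c3f P n * ((n : ℝ) * frakh P.ω n ^ 2)⁻¹) atTop (𝓝 0) := by
  have h1 := ((tendsto_rpow_neg_atTop (y := 1 + 1 / P.ω) (by positivity)).comp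
    tendsto_log_natCast).const_mul (365 * log (5 * P.Q * P.gl ^ (-(1/2) : ℝ)) + 197)
  have h2 := ((tendsto_rpow_neg_atTop (y := 1 / P.ω) (by positivity)).comp
    tendsto_log_natCast).const_mul (730 + 8 * P.r)
  have h := h1.add h2
  rw [mul_zero, mul_zero, add_zero] at h
  refine h.congr' ?_
  filter_upwards [eventually_ge_atTop 2] with n hn
  have hn' : (1 : ℝ) < n := by exact_mod_cast hn
  have hL : 0 < log n := log_pos hn'
  have e : 5 * (n : ℝ) ^ 2 * P.Q * P.gl ^ (-(1/2) : ℝ) =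
      (n : ℝ) ^ 2 * (5 * P.Q * P.gl ^ (-(1/2) : ℝ)) := by ring
  have e2 : log n ^ (-(1 / P.ω)) = log n * log n ^ (-(1 + 1 / P.ω)) := by
    rw [← rpow_one_add' hL.le (by simp; positivity)]
    congr 1
    ring
  rw [nat_mul_frakh_sq _ (by lia), c3f, e,
    log_mul (x := (n : ℝ) ^ 2) (by positivity) (by positivity), log_pow,
    ← rpow_neg hL.le]
  simp only [Function.comp_apply, e2, Nat.cast_ofNat]
  ring

lemma n1_spec {P : Pars} (hω : 0 < P.ω) (hQ : 0 < P.Q) (hgl : 0 < P.gl) {n : ℕ}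
    (hn : n1 P ≤ n) : ((n : ℝ) * frakh P.ω n ^ 2) ^ (-(1/2) : ℝ) * C3f P n ≤ 1 / 2 := by
  have ht : Tendsto (fun n : ℕ => ((n : ℝ) * frakh P.ω n ^ 2) ^ (-(1/2) : ℝ) * C3f P n)
      atTop (𝓝 0) := by
    have h0 := tendsto_c3f_mul_inv hω hQ hgl
    have h := (h0.sqrt.const_mul (2 * √2 * P.gl ^ (-(1/2) : ℝ) * Ksup P.K ^ 2)).add
      (h0.const_mul (8 / 3 * P.gl⁻¹ * Ksup P.K ^ 2))
    rw [sqrt_zero, mul_zero, mul_zero, add_zero] at h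
    refine h.congr fun n => ?_
    have hW : 0 ≤ (n : ℝ) * frakh P.ω n ^ 2 := by positivity
    rw [C3f, sqrt_mul' _ (inv_nonneg.2 hW), sqrt_inv, rpow_neg hW, ← sqrt_eq_rpow]
    have e : (√((n : ℝ) * frakh P.ω n ^ 2))⁻¹ * (√((n : ℝ) * frakh P.ω n ^ 2))⁻¹ =
        ((n : ℝ) * frakh P.ω n ^ 2)⁻¹ := by
      rw [← mul_inv, mul_self_sqrt hW]
    rw [← e]
    ring
  obtain ⟨-, h2⟩ := Nat.sInf_mem (exists_forall_of_eventually_atTop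
    (ht.eventually_le_const (show (0 : ℝ) < 1 / 2 by norm_num)))
  exact h2 n hn

end

lemma one_le_rpow_neg_half {x : ℝ} (hx : x ∈ Set.Ioo (0 : ℝ) 1) : 1 ≤ x ^ (-(1/2) : ℝ) :=
  one_le_rpow_of_pos_of_le_one_of_nonpos hx.1 hx.2.le (by norm_num)

lemma rpow_neg_half_sq {x : ℝ} (hx : 0 ≤ x) : (x ^ (-(1/2) : ℝ)) ^ 2 = x⁻¹ := by
  rw [← rpow_natCast, ← rpow_mul hx]
  norm_num [rpow_neg_one]

section

variable {P : Pars} {n : ℕ}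

lemma le_entropy_argument (hK : KernelHyp P.K P.Q) (hgl : P.gl ∈ Set.Ioo (0 : ℝ) 1) :
    10 / 3 * (n : ℝ) ^ 2 ≤ 5 * (n : ℝ) ^ 2 * P.Q * P.gl ^ (-(1/2) : ℝ) := by
  have h1 := hK.one_le_mul_Q
  have h2 := one_le_rpow_neg_half hgl
  have h3 : 2 / 3 ≤ P.Q := by linarith
  calc 10 / 3 * (n : ℝ) ^ 2 = 5 * (n : ℝ) ^ 2 * (2 / 3) * 1 := by ring
    _ ≤ _ := by gcongr

lemma le_c3f (hK : KernelHyp P.K P.Q) (hgl : P.gl ∈ Set.Ioo (0 : ℝ) 1) (hr : 0 ≤ P.r)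
    (hn : 1 ≤ n) : 197 ≤ c3f P n := by
  have h1 := le_entropy_argument (n := n) hK hgl
  have h2 : (1 : ℝ) ≤ n := by exact_mod_cast hn
  have h3 : 0 ≤ log (5 * (n : ℝ) ^ 2 * P.Q * P.gl ^ (-(1/2) : ℝ)) := log_nonneg (by nlinarith)
  have h4 : 0 ≤ log n := log_natCast_nonneg n
  unfold c3f
  have : 0 ≤ P.r * log n := by positivity
  linarith

lemma c3f_le_c4f (hK : KernelHyp P.K P.Q) (hgl : P.gl ∈ Set.Ioo (0 : ℝ) 1)
    (hn : 1 ≤ n) (hτ : 1 ≤ tauf P n) : c3f P n ≤ c4f P n := by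
  have h1 := le_entropy_argument (n := n) hK hgl
  have h2 : (1 : ℝ) ≤ n := by exact_mod_cast hn
  have h3 : 0 < 5 * (n : ℝ) ^ 2 * P.Q * P.gl ^ (-(1/2) : ℝ) := by nlinarith
  have h4 : 5 * (n : ℝ) ^ 2 * tauf P n * P.Q * P.gl ^ (-(1/2) : ℝ) =
    5 * (n : ℝ) ^ 2 * P.Q * P.gl ^ (-(1/2) : ℝ) * tauf P n := by ring
  unfold c3f c4f
  rw [h4]
  have := log_le_log h3 (le_mul_of_one_le_right h3.le hτ)
  linarith

lemma le_nat_mul_frakh_sq_of_pos (hω : 0 < P.ω) (hK : KernelHyp P.K P.Q)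
    (hgl : P.gl ∈ Set.Ioo (0 : ℝ) 1) (hr : 0 ≤ P.r) (hn : n1 P ≤ n) (hn1 : 1 ≤ n)
    (hW : 0 < (n : ℝ) * frakh P.ω n ^ 2) : 6304 ≤ (n : ℝ) * frakh P.ω n ^ 2 := by
  have hQ : 0 < P.Q := by have := hK.one_le_mul_Q; linarith
  have h := n1_spec hω hQ hgl.1 hn
  have hc := le_c3f hK hgl hr hn1
  have hS := hK.one_le_Ksup
  have hg := one_le_rpow_neg_half hgl
  have hgl0 := hgl.1
  set W := (n : ℝ) * frakh P.ω n ^ 2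
  have h1 : W ^ (-(1/2) : ℝ) * (2 * √2 * √(c3f P n)) ≤ 1 / 2 := by
    refine le_trans ?_ h
    gcongr
    unfold C3f
    have a1 : 1 ≤ P.gl ^ (-(1/2) : ℝ) * Ksup P.K ^ 2 := by nlinarith
    have a2 : 0 ≤ 8 / 3 * P.gl⁻¹ * Ksup P.K ^ 2 * c3f P n * W ^ (-(1/2) : ℝ) := by positivity
    have a3 : 0 ≤ 2 * √2 * √(c3f P n) := by positivity
    nlinarith
  have h2 : (W ^ (-(1/2) : ℝ) * (2 * √2 * √(c3f P n))) ^ 2 ≤ (1 / 2) ^ 2 :=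
    pow_le_pow_left₀ (by positivity) h1 2
  rw [mul_pow, mul_pow, mul_pow, sq_sqrt (by norm_num), sq_sqrt (by linarith),
    rpow_neg_half_sq hW.le, inv_mul_le_iff₀ hW] at h2
  linarith

lemma two_le_and_le_nat_mul_frakh_sq (hω : 0 < P.ω) (hK : KernelHyp P.K P.Q)
    (hgl : P.gl ∈ Set.Ioo (0 : ℝ) 1) (hr : 0 ≤ P.r) (hn : n1 P ≤ n) (hn1 : 1 ≤ n) :
    2 ≤ n ∧ 6304 ≤ (n : ℝ) * frakh P.ω n ^ 2 := by
  have key : ∀ m : ℕ, 2 ≤ m → n1 P ≤ m → 6304 ≤ (m : ℝ) * frakh P.ω m ^ 2 := fun m hm hm1 => by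
    refine le_nat_mul_frakh_sq_of_pos hω hK hgl hr hm1 (by lia) ?_
    rw [nat_mul_frakh_sq _ (by lia)]
    exact rpow_pos_of_pos (log_pos (by exact_mod_cast hm)) _
  have h2 : 2 ≤ n := by
    by_contra! hlt
    have h := key 2 le_rfl (hn.trans (by lia))
    rw [nat_mul_frakh_sq _ (by lia)] at h
    have : log (2 : ℕ) ^ (1 + 1 / P.ω) ≤ 1 :=
      rpow_le_one (log_natCast_nonneg 2) (by have := log_two_lt_d9; norm_num; linarith)
        (by positivity)
    linarith
  exact ⟨h2, key n h2 hn⟩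

lemma frakh_le_one {β₀ M : ℝ} (hβ : 0 < β₀) (h : max M 1 * frakh P.ω n ^ β₀ ≤ 1) :
    frakh P.ω n ≤ 1 := by
  by_contra! hlt
  have h1 := one_lt_rpow hlt hβ
  have h2 : 1 ≤ max M 1 := le_max_right _ _
  nlinarith

lemma one_le_log_and_one_le_mul_log (hω : 0 < P.ω) (hn1 : 1 ≤ n)
    (hh : frakh P.ω n ≤ 1) (hW : 6304 ≤ (n : ℝ) * frakh P.ω n ^ 2) :
    1 ≤ log n ∧ 1 ≤ P.ω * log n := by
  have hn0 : (0 : ℝ) < n := by exact_mod_cast hn1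
  have h0 : 0 ≤ frakh P.ω n := sqrt_nonneg _
  have hWn : (n : ℝ) * frakh P.ω n ^ 2 ≤ n := mul_le_of_le_one_right hn0.le (by nlinarith)
  have he := exp_one_lt_d9
  have h3 : exp 1 ≤ log n := by
    refine le_trans (b := 3) (by linarith) ?_
    rw [le_log_iff_exp_le hn0, show (3 : ℝ) = 1 + 1 + 1 by norm_num, exp_add, exp_add]
    have := exp_pos 1
    nlinarith
  have hL : 0 < log n := (exp_pos 1).trans_le h3
  have h4 : 1 ≤ log (log n) := (le_log_iff_exp_le hL).2 h3
  rw [nat_mul_frakh_sq _ hn1] at hWn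
  have h5 := log_le_log (by positivity) hWn
  rw [log_rpow hL] at h5
  have h6 : 1 / P.ω ≤ log n := by
    have : 0 < 1 / P.ω := by positivity
    nlinarith
  exact ⟨by have := add_one_le_exp (1 : ℝ); linarith, by rwa [div_le_iff₀' hω] at h6⟩

lemma one_le_tauf (hΩc : P.Ωc ∈ Set.Ioc (0 : ℝ) 1) (hω : 0 < P.ω) (hr : 0 ≤ P.r)
    (hL : 1 ≤ log n) : 1 ≤ tauf P n := by
  have h1 : 1 ≤ P.Ωc⁻¹ := (one_le_inv₀ hΩc.1).2 hΩc.2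
  have h2 : 1 ≤ P.Ωc⁻¹ * (4 * P.r + 1) := one_le_mul_of_one_le_of_one_le h1 (by linarith)
  exact one_le_rpow (one_le_mul_of_one_le_of_one_le h2 hL) (by positivity)

lemma nat_mul_noise_tail_le (hΥ : 0 ≤ P.Υ) (hΩc : 0 < P.Ωc) (hω : 0 < P.ω)
    (hr : 0 ≤ P.r) (hn1 : 1 ≤ n) (hωL : 1 ≤ P.ω * log n) :
    n * (2 * (P.Υ * exp (-P.Ωc * (2 * tauf P n) ^ P.ω))) ≤ P.Υ * (n : ℝ) ^ (-(4 * P.r)) := by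
  have hn0 : (0 : ℝ) < n := by exact_mod_cast hn1
  have hL : 0 ≤ log n := log_natCast_nonneg n
  have h1 : P.Ωc * (2 * tauf P n) ^ P.ω = 2 ^ P.ω * ((4 * P.r + 1) * log n) := by
    rw [tauf, mul_rpow (by norm_num) (by positivity), ← rpow_mul (by positivity),
      one_div_mul_cancel hω.ne', rpow_one]
    field_simp
  have h2 : P.ω * log 2 + 1 ≤ 2 ^ P.ω := by
    rw [rpow_def_of_pos two_pos, mul_comm P.ω]
    exact add_one_le_exp _
  have h3 : log 2 ≤ P.ω * log 2 * ((4 * P.r + 1) * log n) := by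
    have a := log_pos one_lt_two
    have b : 1 ≤ (4 * P.r + 1) * (P.ω * log n) :=
      one_le_mul_of_one_le_of_one_le (by linarith) hωL
    nlinarith
  have h4 : (4 * P.r + 1) * log n + log 2 ≤ P.Ωc * (2 * tauf P n) ^ P.ω := by
    rw [h1]
    have : 0 ≤ (4 * P.r + 1) * log n := by positivity
    nlinarith
  calc n * (2 * (P.Υ * exp (-P.Ωc * (2 * tauf P n) ^ P.ω)))
      ≤ n * (2 * (P.Υ * exp (-((4 * P.r + 1) * log n + log 2)))) := by
        gcongr
        linarith
    _ = P.Υ * exp (log n + log 2 - ((4 * P.r + 1) * log n + log 2)) := by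
        rw [sub_eq_add_neg, exp_add (log n + log 2), exp_add (log n), exp_log hn0,
          exp_log two_pos]
        ring
    _ = _ := by
        rw [rpow_def_of_pos hn0]
        ring_nf

lemma grid_card_mul_exp_le (hK : KernelHyp P.K P.Q) (hgl : P.gl ∈ Set.Ioo (0 : ℝ) 1)
    (hn : 2 ≤ n) :
    ((⌈5 * (n : ℝ) ^ 2 * P.Q⌉₊ + 1 : ℕ) : ℝ) ^ 2 * (2 * exp (-(c3f P n / 2))) ≤
      8 * (n : ℝ) ^ (-(4 * P.r)) := by
  have hn2 : (2 : ℝ) ≤ n := by exact_mod_cast hn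
  have hn0 : (0 : ℝ) < n := by linarith
  have h1 := le_entropy_argument (n := n) hK hgl
  have hQ : 0 ≤ P.Q := hK.Q_nonneg
  have h2 : 5 * (n : ℝ) ^ 2 * P.Q ≤ 5 * (n : ℝ) ^ 2 * P.Q * P.gl ^ (-(1/2) : ℝ) :=
    le_mul_of_one_le_right (by positivity) (one_le_rpow_neg_half hgl)
  have h3 := (Nat.ceil_lt_add_one (show 0 ≤ 5 * (n : ℝ) ^ 2 * P.Q by positivity)).le
  unfold c3f
  set A := 5 * (n : ℝ) ^ 2 * P.Q * P.gl ^ (-(1/2) : ℝ)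
  have hA : 2 ≤ A := by nlinarith
  have hA0 : 0 < A := by linarith
  have hlA : 0 ≤ log A := log_nonneg (by linarith)
  have h4 : ((⌈5 * (n : ℝ) ^ 2 * P.Q⌉₊ + 1 : ℕ) : ℝ) ≤ 2 * A := by push_cast; linarith
  calc _ ≤ (2 * A) ^ 2 * (2 * exp (-((365 * log A + 8 * P.r * log n + 197) / 2))) := by gcongr
    _ = 8 * exp (log A + log A - (365 * log A + 8 * P.r * log n + 197) / 2) := by
        rw [sub_eq_add_neg, exp_add (log A + log A), exp_add (log A), exp_log hA0]
        ring
    _ ≤ 8 * exp (log n * (-(4 * P.r))) := by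
        gcongr
        linarith
    _ = _ := by rw [rpow_def_of_pos hn0]

lemma exists_grid_near {N : ℕ} (hN : 1 ≤ N) {y : ℝ} (hy : y ∈ Set.Icc (-(5/2) : ℝ) (5/2)) :
    ∃ j : Fin (N + 1), |y - (-(5/2) + 5 * (j : ℕ) / N)| ≤ 5 / N := by
  have hN0 : (0 : ℝ) < N := by exact_mod_cast hN
  have h0 : 0 ≤ (y + 5/2) * N / 5 := by
    have : 0 ≤ y + 5/2 := by linarith [hy.1]
    positivity
  have h1 := Nat.floor_le h0
  have h2 := Nat.lt_floor_add_one ((y + 5/2) * N / 5)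
  have h3 : ⌊(y + 5/2) * N / 5⌋₊ < N + 1 := by
    rw [Nat.floor_lt h0]
    push_cast
    nlinarith [hy.2]
  refine ⟨⟨_, h3⟩, ?_⟩
  set j : ℝ := (⌊(y + 5/2) * N / 5⌋₊ : ℝ)
  have e : y - (-(5/2) + 5 * j / N) = ((y + 5/2) * N / 5 - j) * (5 / N) := by
    field_simp
    ring
  simp only [e]
  rw [abs_mul, abs_of_nonneg (show (0 : ℝ) ≤ 5 / N by positivity)]
  refine mul_le_of_le_one_left (by positivity) ?_
  rw [abs_of_nonneg (by linarith)]
  linarith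

lemma grid_mem {N : ℕ} (hN : 1 ≤ N) (j : Fin (N + 1)) :
    -(5/2) + 5 * (j : ℕ) / (N : ℝ) ∈ Set.Icc (-(5/2) : ℝ) (5/2) := by
  have hN0 : (0 : ℝ) < N := by exact_mod_cast hN
  have hj : ((j : ℕ) : ℝ) ≤ N := by exact_mod_cast Nat.lt_succ_iff.1 j.2
  have h1 : 5 * (j : ℕ) / (N : ℝ) ≤ 5 := by
    rw [div_le_iff₀ hN0]
    linarith
  have h2 : 0 ≤ 5 * (j : ℕ) / (N : ℝ) := by positivity
  exact ⟨by linarith, by linarith⟩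

end

lemma deviation_budget {N h Φ σ τ G g S c₃ c₄ Q δ : ℝ} (hN : 0 < N) (hh : 0 < h)
    (hNh : 1 ≤ N * h) (hΦ : 0 ≤ Φ) (hσ : 0 ≤ σ) (hτ : 0 ≤ τ) (hG : 0 ≤ G) (hg : 0 ≤ g)
    (hS : 1 ≤ S) (hc₃ : 197 ≤ c₃) (hc : c₃ ≤ c₄) (hQδ : Q * δ ≤ (N ^ 2)⁻¹) :
    2 * (√2 * (Φ + σ) * g * h⁻¹ * S ^ 2) * √(N * (c₃ / 2)) +
        (Φ + 2 * τ) * (G * ((h ^ 2)⁻¹ * S ^ 2)) * (c₃ / 2) +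
        N * (2 * ((Φ + 2 * τ) * (G * ((h ^ 2)⁻¹ * (2 * S * (Q * (δ / h))))))) ≤
      N * ((N * h ^ 2) ^ (-(1/2) : ℝ) *
        (Φ * (2 * √2 * g * S ^ 2 * √c₃ + 8 / 3 * G * S ^ 2 * c₃ * (N * h ^ 2) ^ (-(1/2) : ℝ)) +
          (2 * √2 * σ * g * S ^ 2 * √c₄ +
            8 / 3 * τ * c₄ * (N * h ^ 2) ^ (-(1/2) : ℝ) * G * S ^ 2))) := by
  have hW : 0 < N * h ^ 2 := by positivity
  have hw2 := rpow_neg_half_sq hW.le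
  have hw : (N * h ^ 2) ^ (-(1/2) : ℝ) = (√N)⁻¹ * h⁻¹ := by
    rw [rpow_neg hW.le, ← sqrt_eq_rpow, sqrt_mul hN.le, sqrt_sq hh.le, mul_inv]
  have hNw : N * (N * h ^ 2) ^ (-(1/2) : ℝ) = √N * h⁻¹ := by
    rw [hw, ← mul_assoc]
    congr 1
    nth_rw 1 [← mul_self_sqrt hN.le]
    rw [mul_inv_cancel_right₀ (sqrt_pos.2 hN).ne']
  have hNw2 : N * ((N * h ^ 2) ^ (-(1/2) : ℝ)) ^ 2 = (h ^ 2)⁻¹ := by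
    rw [hw2]
    field_simp
  set w := (N * h ^ 2) ^ (-(1/2) : ℝ)
  have hs : √(N * (c₃ / 2)) * √2 = √N * √c₃ := by
    rw [← sqrt_mul (by positivity), ← sqrt_mul hN.le]
    congr 1
    ring
  have hcc : √c₃ ≤ √c₄ := sqrt_le_sqrt hc
  have h1 : 1 ≤ √2 := one_le_sqrt.2 one_le_two
  have first : 2 * (√2 * (Φ + σ) * g * h⁻¹ * S ^ 2) * √(N * (c₃ / 2)) ≤
      (√N * h⁻¹) * (Φ * (2 * √2 * g * S ^ 2 * √c₃) + 2 * √2 * σ * g * S ^ 2 * √c₄) := by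
    calc _ = (√(N * (c₃ / 2)) * √2) * h⁻¹ * (2 * (Φ + σ) * g * S ^ 2) := by ring
      _ = (√N * h⁻¹) * (Φ * (2 * 1 * g * S ^ 2 * √c₃) + 2 * 1 * σ * g * S ^ 2 * √c₃) := by
        rw [hs]; ring
      _ ≤ _ := by gcongr
  have third : N * (2 * ((Φ + 2 * τ) * (G * ((h ^ 2)⁻¹ * (2 * S * (Q * (δ / h))))))) ≤
      8 * (Φ + τ) * (G * ((h ^ 2)⁻¹ * S ^ 2)) := by
    have a1 : N * (Q * δ / h) ≤ 1 := by
      calc N * (Q * δ / h) ≤ N * ((N ^ 2)⁻¹ / h) := by gcongr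
        _ = (N * h)⁻¹ := by field_simp
        _ ≤ 1 := inv_le_one_of_one_le₀ hNh
    calc _ = 4 * (Φ + 2 * τ) * (G * ((h ^ 2)⁻¹ * S)) * (N * (Q * δ / h)) := by ring
      _ ≤ 4 * (Φ + 2 * τ) * (G * ((h ^ 2)⁻¹ * S)) * 1 := by gcongr
      _ ≤ 4 * (2 * (Φ + τ)) * (G * ((h ^ 2)⁻¹ * S ^ 2)) * 1 := by
        gcongr
        · linarith
        · nlinarith
      _ = _ := by ring
  have second : (Φ + 2 * τ) * (G * ((h ^ 2)⁻¹ * S ^ 2)) * (c₃ / 2) +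
      8 * (Φ + τ) * (G * ((h ^ 2)⁻¹ * S ^ 2)) ≤
      (h ^ 2)⁻¹ * (Φ * (8 / 3 * G * S ^ 2 * c₃) + 8 / 3 * τ * c₄ * G * S ^ 2) := by
    have b : (Φ + 2 * τ) * (c₃ / 2) + 8 * (Φ + τ) ≤ 8 / 3 * (Φ * c₃ + τ * c₄) := by
      nlinarith [mul_le_mul_of_nonneg_left hc hτ, mul_le_mul_of_nonneg_left hc₃ hΦ,
        mul_le_mul_of_nonneg_left hc₃ hτ]
    calc _ = ((Φ + 2 * τ) * (c₃ / 2) + 8 * (Φ + τ)) * (G * ((h ^ 2)⁻¹ * S ^ 2)) := by ring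
      _ ≤ (8 / 3 * (Φ * c₃ + τ * c₄)) * (G * ((h ^ 2)⁻¹ * S ^ 2)) := by gcongr
      _ = _ := by ring
  have e : N * (w * (Φ * (2 * √2 * g * S ^ 2 * √c₃ + 8 / 3 * G * S ^ 2 * c₃ * w) +
      (2 * √2 * σ * g * S ^ 2 * √c₄ + 8 / 3 * τ * c₄ * w * G * S ^ 2))) =
      (N * w) * (Φ * (2 * √2 * g * S ^ 2 * √c₃) + 2 * √2 * σ * g * S ^ 2 * √c₄) +
      (N * w ^ 2) * (Φ * (8 / 3 * G * S ^ 2 * c₃) + 8 / 3 * τ * c₄ * G * S ^ 2) := by ring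
  rw [e, hNw, hNw2]
  linarith

lemma abs_dot2_sub_le {θ x v : Fin 2 → ℝ} (hθ : θ ∈ S1) {h : ℝ}
    (hx : ∀ k, |x k - v k| ≤ h / 2) : |dot2 x θ - dot2 v θ| ≤ h := by
  rw [S1, Set.mem_ofPred_eq] at hθ
  have e : dot2 x θ - dot2 v θ = (x 0 - v 0) * θ 0 + (x 1 - v 1) * θ 1 := by
    unfold dot2
    ring
  have h0 : |θ 0| ≤ 1 := abs_le_one_iff_mul_self_le_one.2 (by nlinarith [sq_nonneg (θ 1)])
  have h1 : |θ 1| ≤ 1 := abs_le_one_iff_mul_self_le_one.2 (by nlinarith [sq_nonneg (θ 0)])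
  calc _ ≤ |x 0 - v 0| * |θ 0| + |x 1 - v 1| * |θ 1| := by
        rw [e, ← abs_mul, ← abs_mul]
        exact abs_add_le _ _
    _ ≤ |x 0 - v 0| * 1 + |x 1 - v 1| * 1 := by gcongr
    _ ≤ h := by linarith [hx 0, hx 1]

lemma continuous_of_abs_sub_le_rpow {f : ℝ → ℝ} {B β : ℝ} (hβ : 0 < β)
    (hf : ∀ y₁ y₂ : ℝ, |f y₁ - f y₂| ≤ B * |y₁ - y₂| ^ β) : Continuous f := by
  refine continuous_iff_continuousAt.2 fun a => tendsto_iff_dist_tendsto_zero.2 ?_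
  have h : Filter.Tendsto (fun y => B * |y - a| ^ β) (nhds a) (nhds 0) := by
    have hc : ContinuousAt (fun y => B * |y - a| ^ β) a :=
      (((continuous_id.sub continuous_const).abs.continuousAt).rpow_const
        (Or.inr hβ.le)).const_mul B
    simpa [ContinuousAt, zero_rpow hβ.ne'] using hc
  exact squeeze_zero (fun _ => dist_nonneg) (fun y => hf y a) h

section

variable {F : (Fin 2 → ℝ) → ℝ} {P : Pars} {n : ℕ}

lemma FsupNorm_eq_csSup (F : (Fin 2 → ℝ) → ℝ) :
    FsupNorm F = sSup ((fun x => |F x|) '' square) := by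
  unfold FsupNorm
  congr 1
  ext w
  simp only [Set.mem_image, Set.mem_ofPred_eq, eq_comm]

lemma le_FsupNorm {A : ℝ} (hA : ∀ x, |F x| ≤ A) {x : Fin 2 → ℝ} (hx : x ∈ square) :
    |F x| ≤ FsupNorm F := by
  rw [FsupNorm_eq_csSup]
  exact le_csSup ⟨A, Set.forall_mem_image.2 fun x _ => hA x⟩ (Set.mem_image_of_mem _ hx)

lemma square_nonempty : square.Nonempty :=
  ⟨0, fun _ => by norm_num, fun _ => by norm_num⟩

lemma FsupNorm_le {A : ℝ} (hA : ∀ x ∈ square, |F x| ≤ A) : FsupNorm F ≤ A := by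
  rw [FsupNorm_eq_csSup]
  exact csSup_le (square_nonempty.image _) (Set.forall_mem_image.2 hA)

lemma FhatInf_mem_Icc {A : ℝ} (hA : ∀ x, |F x| ≤ A) {d : Fin n → (Fin 2 → ℝ) × ℝ}
    (hd : ∀ v ∈ square, |FhatAux P n d v - F v| ≤ C5f P n + FsupNorm F / 2) :
    FhatInf P n d ∈ Set.Icc (FsupNorm F) (3 * A + 4 * C5f P n) := by
  have hle : ∀ v ∈ square, |FhatAux P n d v| ≤ C5f P n + 3 / 2 * FsupNorm F := fun v hv => by
    have h1 := le_FsupNorm hA hv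
    have h2 := abs_sub_abs_le_abs_sub (FhatAux P n d v) (F v)
    linarith [hd v hv]
  have hS : FhatInf P n d = 2 * FsupNorm (FhatAux P n d) + 2 * C5f P n := rfl
  have hA' : FsupNorm F ≤ A := FsupNorm_le fun x _ => hA x
  have hup : FsupNorm (FhatAux P n d) ≤ C5f P n + 3 / 2 * FsupNorm F := FsupNorm_le hle
  have hlow : FsupNorm F ≤ FsupNorm (FhatAux P n d) + (C5f P n + FsupNorm F / 2) :=
    FsupNorm_le fun v hv => by
      have h1 : |FhatAux P n d v| ≤ FsupNorm (FhatAux P n d) := by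
        rw [FsupNorm_eq_csSup]
        exact le_csSup ⟨_, Set.forall_mem_image.2 hle⟩ (Set.mem_image_of_mem _ hv)
      have h2 := abs_sub_abs_le_abs_sub (F v) (FhatAux P n d v)
      rw [abs_sub_comm] at h2
      linarith [hd v hv]
  rw [hS]
  exact ⟨by linarith, by linarith⟩

lemma FhatAux_eq_sum_truncObs {T : ℝ} {d : Fin n → (Fin 2 → ℝ) × ℝ}
    (hd : ∀ i, |(d i).2 - F (d i).1| ≤ T) (v : Fin 2 → ℝ) :
    FhatAux P n d v = (n : ℝ)⁻¹ * ∑ i, truncObs P.K P.g F (frakh P.ω n) T v (d i) := by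
  unfold FhatAux truncObs scaledK
  congr 1
  refine Finset.sum_congr rfl fun i _ => ?_
  have h : trunc T ((d i).2 - F (d i).1) = (d i).2 - F (d i).1 := if_pos (hd i)
  rw [h]
  ring

end

section

variable {K : ℝ → ℝ} {Q : ℝ} {g F : (Fin 2 → ℝ) → ℝ} {p : ℝ → ℝ} {gl h T Φ : ℝ}
  {v w : Fin 2 → ℝ} {P : Pars}

lemma abs_integral_truncObs_sub_le (hg : DesignOK g gl) (hgl : 0 < gl) (hK : KernelHyp K Q)
    (hh : 0 < h) (hh1 : h ≤ 1) (hv : v ∈ square) (hw : w ∈ square) (hT : 0 ≤ T) (hΦ0 : 0 ≤ Φ)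
    (hF : Measurable F)
    (hΦ : ∀ u ∈ square, ∀ x, (∀ k, |x k - u k| ≤ h / 2) → |F x| ≤ Φ)
    (hp : p ∈ NoiseClass P.Υ P.Ωc P.ω) {δ : ℝ} (hvw : ∀ k, |v k - w k| ≤ δ) :
    |∫ z, truncObs K g F h T v z ∂jointLaw g p F - ∫ z, truncObs K g F h T w z ∂jointLaw g p F|
      ≤ (Φ + T) * (gl⁻¹ * ((h ^ 2)⁻¹ * (2 * Ksup K * (Q * (δ / h))))) := by
  have := isProbabilityMeasure_jointLaw hg hF hp
  have hi : ∀ u ∈ square, Integrable (truncObs K g F h T u) (jointLaw g p F) := fun u hu =>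
    Integrable.of_bound (aestronglyMeasurable_truncObs
      (integrable_of_integral_eq_one' hg.2.1).aemeasurable hK hF) _
      (Filter.Eventually.of_forall fun z =>
        abs_truncObs_le hg hgl hK hh hh1 hu hT hΦ0 (hΦ u hu) z)
  rw [← integral_sub (hi v hv) (hi w hw)]
  have := norm_integral_le_of_norm_le_const (μ := jointLaw g p F)
    (f := fun z => truncObs K g F h T v z - truncObs K g F h T w z)
    (Filter.Eventually.of_forall fun z =>
      abs_truncObs_sub_le hg hgl hK hh hh1 hv hw hT hΦ0 hΦ hvw z)
  simpa using this

lemma abs_sum_truncObs_sub_le (hg : DesignOK g gl) (hgl : 0 < gl) (hK : KernelHyp K Q)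
    (hh : 0 < h) (hh1 : h ≤ 1) (hv : v ∈ square) (hw : w ∈ square) (hT : 0 ≤ T) (hΦ0 : 0 ≤ Φ)
    (hF : Continuous F)
    (hΦ : ∀ u ∈ square, ∀ x, (∀ k, |x k - u k| ≤ h / 2) → |F x| ≤ Φ)
    (hF1 : ∀ x, (∀ k, |x k - v k| ≤ h / 2) → |F x - F v| ≤ 1)
    (hp : p ∈ NoiseClass P.Υ P.Ωc P.ω) {δ : ℝ} (hvw : ∀ k, |v k - w k| ≤ δ)
    {n : ℕ} {d : Fin n → (Fin 2 → ℝ) × ℝ} {ρ : ℝ}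
    (hd : |∑ i, truncObs K g F h T w (d i) -
      n * ∫ z, truncObs K g F h T w z ∂jointLaw g p F| ≤ ρ) :
    |∑ i, truncObs K g F h T v (d i) - n * F v| ≤
      ρ + n * (2 * ((Φ + T) * (gl⁻¹ * ((h ^ 2)⁻¹ * (2 * Ksup K * (Q * (δ / h))))))) +
        n * K1 K ^ 2 := by
  set D := (Φ + T) * (gl⁻¹ * ((h ^ 2)⁻¹ * (2 * Ksup K * (Q * (δ / h)))))
  have h1 : |∑ i, truncObs K g F h T v (d i) - ∑ i, truncObs K g F h T w (d i)| ≤ n * D := by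
    rw [← Finset.sum_sub_distrib]
    refine (Finset.abs_sum_le_sum_abs _ _).trans ((Finset.sum_le_card_nsmul _ _ D fun i _ =>
      abs_truncObs_sub_le hg hgl hK hh hh1 hv hw hT hΦ0 hΦ hvw (d i)).trans_eq ?_)
    simp
  have h2 := mul_le_mul_of_nonneg_left (abs_integral_truncObs_sub_le hg hgl hK hh hh1 hv hw hT hΦ0
    hF.measurable hΦ hp hvw) n.cast_nonneg
  have h3 := abs_integral_scaledK_mul_sub_le hK hh hF hF1
  rw [← integral_truncObs hg hgl hK hh hh1 hv hT hF.measurable (hΦ v hv) hp] at h3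
  have h3 := mul_le_mul_of_nonneg_left h3 n.cast_nonneg
  rw [← abs_of_nonneg (n.cast_nonneg (α := ℝ)), ← abs_mul, abs_of_nonneg (n.cast_nonneg (α := ℝ))]
    at h2 h3
  have e : ∑ i, truncObs K g F h T v (d i) - n * F v =
      (∑ i, truncObs K g F h T v (d i) - ∑ i, truncObs K g F h T w (d i)) +
      (∑ i, truncObs K g F h T w (d i) - n * ∫ z, truncObs K g F h T w z ∂jointLaw g p F) -
      n * (∫ z, truncObs K g F h T v z ∂jointLaw g p F -
        ∫ z, truncObs K g F h T w z ∂jointLaw g p F) +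
      n * (∫ z, truncObs K g F h T v z ∂jointLaw g p F - F v) := by ring
  rw [e]
  have a1 := abs_le.1 h1
  have a2 := abs_le.1 h2
  have a3 := abs_le.1 h3
  have a4 := abs_le.1 hd
  rw [abs_le]
  constructor <;> linarith [a1.1, a1.2, a2.1, a2.2, a3.1, a3.2, a4.1, a4.2]

end

lemma measure_pi_exists_le {α : Type*} [MeasurableSpace α] (μ : Measure α)
    [IsProbabilityMeasure μ] {s : Set α} (hs : MeasurableSet s) {ε : ℝ}
    (h : μ s ≤ ENNReal.ofReal ε) (n : ℕ) :
    Measure.pi (fun _ : Fin n => μ) (⋃ i, {d | d i ∈ s}) ≤ ENNReal.ofReal (n * ε) := by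
  refine (measure_iUnion_fintype_le _ _).trans ?_
  have (i : Fin n) : Measure.pi (fun _ : Fin n => μ) {d | d i ∈ s} = μ s :=
    (measurePreserving_eval (fun _ : Fin n => μ) i).measure_preimage hs.nullMeasurableSet
  simp only [this, Finset.sum_const, Finset.card_univ, Fintype.card_fin, nsmul_eq_mul]
  rw [ENNReal.ofReal_mul n.cast_nonneg, ENNReal.ofReal_natCast]
  gcongr

/-- The deviation level of the truncated sums at the points of the grid. -/
def gridDeviation (P : Pars) (n : ℕ) (Φ : ℝ) : ℝ :=
  2 * (√2 * (Φ + max √(sigma2 P) 1) * P.gl ^ (-(1/2) : ℝ) * (frakh P.ω n)⁻¹ * Ksup P.K ^ 2) *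
      √(n * (c3f P n / 2)) +
    (Φ + 2 * tauf P n) * (P.gl⁻¹ * ((frakh P.ω n ^ 2)⁻¹ * Ksup P.K ^ 2)) * (c3f P n / 2)

lemma dataLaw_deviation_le {P : Pars} {n : ℕ} {F : (Fin 2 → ℝ) → ℝ} {p : ℝ → ℝ} {Φ : ℝ}
    {v : Fin 2 → ℝ} (hΥ : 0 < P.Υ) (hΩc : 0 < P.Ωc) (hω : 0 < P.ω)
    (hK : KernelHyp P.K P.Q) (hgl : P.gl ∈ Set.Ioo (0 : ℝ) 1) (hg : DesignOK P.g P.gl)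
    (hn : 0 < n) (hh : 0 < frakh P.ω n) (hh1 : frakh P.ω n ≤ 1) (hv : v ∈ square)
    (hF : Measurable F) (hΦ0 : 0 < Φ) (hτ : 0 ≤ tauf P n) (hc : 0 < c3f P n)
    (hΦ : ∀ x, (∀ k, |x k - v k| ≤ frakh P.ω n / 2) → |F x| ≤ Φ)
    (hp : p ∈ NoiseClass P.Υ P.Ωc P.ω) :
    dataLaw n P.g p F {d | gridDeviation P n Φ ≤
        |∑ i, truncObs P.K P.g F (frakh P.ω n) (2 * tauf P n) v (d i) -
          n * ∫ z, truncObs P.K P.g F (frakh P.ω n) (2 * tauf P n) v z ∂jointLaw P.g p F|} ≤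
      ENNReal.ofReal (2 * exp (-(c3f P n / 2))) := by
  have hprob := isProbabilityMeasure_jointLaw hg hF hp
  have hgl0 := hgl.1
  have hS := zero_lt_one.trans_le hK.one_le_Ksup
  have hσ : 0 ≤ sigma2 P := (integral_nonneg fun y => sq_nonneg y).trans
    (NoiseClass.integral_sq_le_sigma2 hp hΥ hΩc hω)
  have hσ' : sigma2 P ≤ max √(sigma2 P) 1 ^ 2 := by
    nth_rw 1 [← sq_sqrt hσ]
    gcongr
    exact le_max_left _ _
  have hσ0 : 0 < max √(sigma2 P) 1 := lt_max_of_lt_right one_pos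
  refine pi_abs_deviation_le _ (aestronglyMeasurable_truncObs
    (integrable_of_integral_eq_one' hg.2.1).aemeasurable hK hF) (by positivity) (by positivity)
    (by positivity) (abs_truncObs_le hg hgl0 hK hh hh1 hv (by positivity) hΦ0.le hΦ)
    ((integral_truncObs_sq_le hg hgl0 hK hh hh1 hv hF hΦ hp hΥ hΩc hω).trans ?_) hn
  have e : (√2 * (Φ + max √(sigma2 P) 1) * P.gl ^ (-(1/2) : ℝ) * (frakh P.ω n)⁻¹ *
      Ksup P.K ^ 2) ^ 2 =
      2 * (Φ + max √(sigma2 P) 1) ^ 2 * (P.gl⁻¹ * ((frakh P.ω n ^ 2)⁻¹ * Ksup P.K ^ 4)) := by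
    rw [← rpow_neg_half_sq hgl0.le]
    have : √2 ^ 2 = 2 := sq_sqrt (by norm_num)
    simp only [mul_pow, this, inv_pow]
    ring
  rw [e]
  gcongr
  nlinarith

lemma gridDeviation_add_le {P : Pars} {n : ℕ} {Φ δ : ℝ} (hn : 0 < n)
    (hh : 0 < frakh P.ω n) (hnh : 1 ≤ n * frakh P.ω n) (hΦ : 0 ≤ Φ) (hτ : 0 ≤ tauf P n)
    (hgl : 0 ≤ P.gl) (hS : 1 ≤ Ksup P.K) (hc : 197 ≤ c3f P n) (hc34 : c3f P n ≤ c4f P n)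
    (hδ : P.Q * δ ≤ ((n : ℝ) ^ 2)⁻¹) :
    gridDeviation P n Φ + n * (2 * ((Φ + 2 * tauf P n) *
        (P.gl⁻¹ * ((frakh P.ω n ^ 2)⁻¹ * (2 * Ksup P.K * (P.Q * (δ / frakh P.ω n))))))) ≤
      n * (((n : ℝ) * frakh P.ω n ^ 2) ^ (-(1/2) : ℝ) * (Φ * C3f P n + C4f P n)) :=
  deviation_budget (by exact_mod_cast hn) hh hnh hΦ (le_max_of_le_right zero_le_one) hτ
    (inv_nonneg.2 hgl) (rpow_nonneg hgl _) hS hc hc34 hδ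

/-- The point of `[-5/2, 5/2]²` with grid coordinates `j`. -/
def gridPoint (N : ℕ) (j : Fin 2 → Fin (N + 1)) (k : Fin 2) : ℝ := -(5/2) + 5 * (j k : ℕ) / N

lemma abs_le_FsupNorm_add_one {F : (Fin 2 → ℝ) → ℝ} {h A : ℝ} (hA : ∀ x, |F x| ≤ A)
    (hF : ∀ x v, (∀ k, |x k - v k| ≤ h / 2) → |F x - F v| ≤ 1) {u : Fin 2 → ℝ}
    (hu : u ∈ square) (x : Fin 2 → ℝ) (hx : ∀ k, |x k - u k| ≤ h / 2) :
    |F x| ≤ FsupNorm F + 1 := by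
  have h1 := le_FsupNorm hA hu
  have h2 := abs_sub_abs_le_abs_sub (F x) (F u)
  linarith [hF x u hx]

lemma abs_FhatAux_sub_le {P : Pars} {n N : ℕ} {F : (Fin 2 → ℝ) → ℝ} {p : ℝ → ℝ} {A : ℝ}
    (hK : KernelHyp P.K P.Q) (hgl : P.gl ∈ Set.Ioo (0 : ℝ) 1) (hg : DesignOK P.g P.gl)
    (hn : 0 < n) (hh : 0 < frakh P.ω n) (hh1 : frakh P.ω n ≤ 1)
    (hnh : 1 ≤ n * frakh P.ω n) (hF : Continuous F) (hA : ∀ x, |F x| ≤ A)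
    (hF1 : ∀ x v, (∀ k, |x k - v k| ≤ frakh P.ω n / 2) → |F x - F v| ≤ 1)
    (hτ : 0 ≤ tauf P n) (hc : 197 ≤ c3f P n) (hc34 : c3f P n ≤ c4f P n)
    (hn1 : ((n : ℝ) * frakh P.ω n ^ 2) ^ (-(1/2) : ℝ) * C3f P n ≤ 1 / 2)
    (hN : 1 ≤ N) (hNQ : P.Q * (5 / N) ≤ ((n : ℝ) ^ 2)⁻¹)
    (hp : p ∈ NoiseClass P.Υ P.Ωc P.ω) {d : Fin n → (Fin 2 → ℝ) × ℝ}
    (hd : ∀ i, |(d i).2 - F (d i).1| ≤ 2 * tauf P n)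
    (hgrid : ∀ j : Fin 2 → Fin (N + 1),
      |∑ i, truncObs P.K P.g F (frakh P.ω n) (2 * tauf P n) (gridPoint N j) (d i) -
        n * ∫ z, truncObs P.K P.g F (frakh P.ω n) (2 * tauf P n) (gridPoint N j) z
          ∂jointLaw P.g p F| ≤ gridDeviation P n (FsupNorm F + 1))
    {v : Fin 2 → ℝ} (hv : v ∈ square) :
    |FhatAux P n d v - F v| ≤ C5f P n + FsupNorm F / 2 := by
  have hn0 : (0 : ℝ) < n := by exact_mod_cast hn
  have hF0 : 0 ≤ FsupNorm F := (abs_nonneg _).trans (le_FsupNorm hA hv)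
  choose j hj using fun k => exists_grid_near hN (y := v k) ⟨hv.1 k, hv.2 k⟩
  have hw : gridPoint N j ∈ square :=
    ⟨fun k => (grid_mem hN (j k)).1, fun k => (grid_mem hN (j k)).2⟩
  have h1 := abs_sum_truncObs_sub_le hg hgl.1 hK hh hh1 hv hw (by positivity)
    (by positivity : 0 ≤ FsupNorm F + 1) hF
    (fun u hu x => abs_le_FsupNorm_add_one hA hF1 hu x) (fun x => hF1 x v) hp hj (hgrid j)
  have h2 := gridDeviation_add_le hn hh hnh (by positivity : 0 ≤ FsupNorm F + 1) hτ hgl.1.le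
    hK.one_le_Ksup hc hc34 hNQ
  rw [FhatAux_eq_sum_truncObs hd]
  set S := ∑ i, truncObs P.K P.g F (frakh P.ω n) (2 * tauf P n) v (d i)
  have e : (n : ℝ)⁻¹ * S - F v = (n : ℝ)⁻¹ * (S - n * F v) := by field_simp
  rw [e, abs_mul, abs_of_pos (inv_pos.2 hn0), inv_mul_le_iff₀ hn0]
  refine (h1.trans (add_le_add_left h2 _)).trans ?_
  rw [← mul_add]
  refine mul_le_mul_of_nonneg_left ?_ hn0.le
  have h3 := mul_le_mul_of_nonneg_left hn1 (by positivity : 0 ≤ FsupNorm F + 1)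
  unfold C5f
  linarith

/-- Lemma 3: under Assumptions 1–4, for any `n ≥ n₀ ∨ n₁`,
uniformly over `θ* ∈ S¹` and `f ∈ F(β₀,M)`,
`P_F(F̂_∞ ∉ [‖F‖_∞, 3M + 4C₅(n)]) ≤ (8+Υ) n^{-4r}`. -/
theorem FhatInf_concentration
    (P : Pars) (β₀ M : ℝ)
    (hβ₀ : β₀ ∈ Set.Ioo (0 : ℝ) 1) (hM : 0 < M)
    (hΥ : 0 < P.Υ) (hΩc : P.Ωc ∈ Set.Ioc (0 : ℝ) 1) (hω : 0 < P.ω)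
    (hK : KernelHyp P.K P.Q)
    (hgl : P.gl ∈ Set.Ioo (0 : ℝ) 1) (hg : DesignOK P.g P.gl)
    (hr : 1 ≤ P.r)
    (n : ℕ) (hn : max (n0 β₀ M P.ω) (n1 P) ≤ n)
    (f : ℝ → ℝ) (hf : f ∈ HolderBall β₀ M)
    (θ : Fin 2 → ℝ) (hθ : θ ∈ S1)
    (p : ℝ → ℝ) (hp : p ∈ NoiseClass P.Υ P.Ωc P.ω) :
    dataLaw n P.g p (fun x => f (dot2 x θ))
        {d | FhatInf P n d ∉
          Set.Icc (FsupNorm fun x => f (dot2 x θ)) (3 * M + 4 * C5f P n)}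
      ≤ ENNReal.ofReal ((8 + P.Υ) * (n : ℝ) ^ (-(4 * P.r))) := by
  obtain ⟨A, B, hAB, hA, hB⟩ := hf
  have hA0 : 0 ≤ A := (abs_nonneg _).trans (hA 0)
  have hB0 : 0 ≤ B := by simpa using (abs_nonneg _).trans (hB 0 1)
  obtain ⟨hn1, hMh⟩ := n0_spec hβ₀.1 ((le_max_left _ _).trans hn)
  have hn1' := (le_max_right _ _).trans hn
  have hr0 : 0 ≤ P.r := by linarith
  obtain ⟨hn2, hW⟩ := two_le_and_le_nat_mul_frakh_sq hω hK hgl hr0 hn1' hn1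
  have hQ : 0 < P.Q := by linarith [hK.one_le_mul_Q]
  have hC3 := n1_spec hω hQ hgl.1 hn1'
  have hh1 := frakh_le_one hβ₀.1 hMh
  have hh : 0 < frakh P.ω n := (sqrt_nonneg _).lt_of_ne fun h0 => by
    rw [frakh, ← h0] at hW
    norm_num at hW
  obtain ⟨hL, hωL⟩ := one_le_log_and_one_le_mul_log hω hn1 hh1 hW
  have hτ := one_le_tauf hΩc hω hr0 hL
  have hτ0 : 0 ≤ tauf P n := by linarith
  have hc := le_c3f hK hgl hr0 hn1
  have hc34 := c3f_le_c4f hK hgl hn1 hτ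
  have hn0 : (0 : ℝ) < n := by exact_mod_cast hn1
  have hnh : 1 ≤ n * frakh P.ω n := by nlinarith [mul_pos hn0 hh]
  set F : (Fin 2 → ℝ) → ℝ := fun x => f (dot2 x θ)
  have hFc : Continuous F := (continuous_of_abs_sub_le_rpow hβ₀.1 hB).comp (by
    unfold dot2
    fun_prop)
  have hFA : ∀ x, |F x| ≤ A := fun x => hA _
  have hF1 : ∀ x v : Fin 2 → ℝ, (∀ k, |x k - v k| ≤ frakh P.ω n / 2) → |F x - F v| ≤ 1 :=
    fun x v hx => by
      have h1 := abs_dot2_sub_le hθ hx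
      have h2 : B ≤ max M 1 := le_max_of_le_left (by linarith)
      refine (hB _ _).trans (le_trans ?_ hMh)
      gcongr
      exact hβ₀.1.le
  have hΦ := fun u hu x => abs_le_FsupNorm_add_one hFA hF1 (u := u) hu x
  have hF0 : 0 ≤ FsupNorm F := by
    obtain ⟨x, hx⟩ := square_nonempty
    exact (abs_nonneg _).trans (le_FsupNorm hFA hx)
  have hprob := isProbabilityMeasure_jointLaw hg hFc.measurable hp
  set N := ⌈5 * (n : ℝ) ^ 2 * P.Q⌉₊
  have hN : 1 ≤ N := Nat.one_le_iff_ne_zero.2 (Nat.ceil_pos.2 (by positivity)).ne'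
  have hNQ : P.Q * (5 / N) ≤ ((n : ℝ) ^ 2)⁻¹ := by
    have h1 : 5 * (n : ℝ) ^ 2 * P.Q ≤ N := Nat.le_ceil _
    have h2 : (0 : ℝ) < N := by exact_mod_cast hN
    rw [← mul_div_assoc, div_le_iff₀ h2, inv_mul_eq_div, le_div_iff₀ (by positivity)]
    linarith
  set T := 2 * tauf P n
  have hcover : {d | FhatInf P n d ∉ Set.Icc (FsupNorm F) (3 * M + 4 * C5f P n)} ⊆
      (⋃ i, {d : Fin n → (Fin 2 → ℝ) × ℝ | d i ∈ {z | T < |z.2 - F z.1|}}) ∪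
      ⋃ j : Fin 2 → Fin (N + 1), {d | gridDeviation P n (FsupNorm F + 1) ≤
        |∑ i, truncObs P.K P.g F (frakh P.ω n) T (gridPoint N j) (d i) -
          n * ∫ z, truncObs P.K P.g F (frakh P.ω n) T (gridPoint N j) z
            ∂jointLaw P.g p F|} := by
    intro d hd
    by_contra hcon
    simp only [Set.mem_union, Set.mem_iUnion, Set.mem_ofPred_eq, not_or, not_exists,
      not_le, not_lt] at hcon
    obtain ⟨hnoise, hgrid⟩ := hcon
    have hmem := FhatInf_mem_Icc hFA fun v hv => abs_FhatAux_sub_le hK hgl hg hn1 hh hh1 hnh hFc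
      hFA hF1 hτ0 hc hc34 hC3 hN hNQ hp hnoise (fun j => (hgrid j).le) hv
    exact hd ⟨hmem.1, hmem.2.trans (by linarith)⟩
  have hnoise := measure_pi_exists_le (jointLaw P.g p F)
    (measurableSet_lt measurable_const (by have := hFc.measurable; fun_prop))
    (jointLaw_noise_tail_le hg hFc.measurable hp (by positivity : 0 ≤ T)) n
  have hdev := fun j : Fin 2 → Fin (N + 1) =>
    have hw : gridPoint N j ∈ square :=
      ⟨fun k => (grid_mem hN (j k)).1, fun k => (grid_mem hN (j k)).2⟩
    dataLaw_deviation_le hΥ hΩc.1 hω hK hgl hg hn1 hh hh1 hw hFc.measurable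
      (by positivity : 0 < FsupNorm F + 1) hτ0 (by linarith) (hΦ _ hw) hp
  have hgridsum := (measure_iUnion_fintype_le (dataLaw n P.g p F) _).trans
    (Finset.sum_le_card_nsmul _ _ _ fun j _ => hdev j)
  refine (measure_mono hcover).trans ((measure_union_le _ _).trans
    ((add_le_add hnoise hgridsum).trans ?_))
  rw [nsmul_eq_mul, ← ENNReal.ofReal_natCast, ← ENNReal.ofReal_mul (Nat.cast_nonneg _),
    ← ENNReal.ofReal_add (by positivity) (by positivity)]
  refine ENNReal.ofReal_le_ofReal ?_
  have h1 := nat_mul_noise_tail_le hΥ.le hΩc.1 hω hr0 hn1 hωL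
  have h2 := grid_card_mul_exp_le hK hgl hn2
  have hcard : ((Finset.univ : Finset (Fin 2 → Fin (N + 1))).card : ℝ) =
      ((N + 1 : ℕ) : ℝ) ^ 2 := by simp
  rw [hcard]
  linarith

end SingleIndex
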